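/- arXiv:1806.06932 — 2 statements merged into one kernel-verified Lean document; each statement's English description precedes it below -/
import Mathlib

section
/- Let G be a weak near-triangulation, let u be a problematic vertex of G, and let x be a u-bad vertex in G. Then x is an external vertex of G, x is adjacent to u, and there exists a vertex y such that uxy is a facial triangle of G. -/
open Set

/-- A plane graph: a finite simple graph whose vertices are points of the plane,
together with a plane embedding in which every edge is drawn as an arc (the range of an
injective path) joining its endpoints, two arcs meet only in common endpoints, and
no vertex lies on an arc other than at its endpoints. -/
structure PlaneGraph where
  verts : Set (ℝ × ℝ)
  finite_verts : verts.Finite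
  Adj : (ℝ × ℝ) → (ℝ × ℝ) → Prop
  adj_symm : ∀ u v, Adj u v → Adj v u
  adj_irrefl : ∀ v, ¬ Adj v v
  adj_mem : ∀ u v, Adj u v → u ∈ verts
  arc : (ℝ × ℝ) → (ℝ × ℝ) → Set (ℝ × ℝ)
  arc_symm : ∀ u v, arc u v = arc v u
  arc_path : ∀ u v, Adj u v → ∃ γ : Path u v, Function.Injective ⇑γ ∧ arc u v = Set.range ⇑γ
  arc_verts : ∀ u v, Adj u v → verts ∩ arc u v ⊆ {u, v}
  arc_inter : ∀ u v u' v', Adj u v → Adj u' v' → ({u, v} : Set (ℝ × ℝ)) ≠ {u', v'} →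
    arc u v ∩ arc u' v' ⊆ ({u, v} : Set (ℝ × ℝ)) ∩ {u', v'}

namespace PlaneGraph

/-- The plane subgraph induced on a set of vertices, with the inherited embedding. -/
def induce (G : PlaneGraph) (S : Set (ℝ × ℝ)) : PlaneGraph where
  verts := G.verts ∩ S
  finite_verts := G.finite_verts.subset inter_subset_left
  Adj u v := G.Adj u v ∧ u ∈ S ∧ v ∈ S
  adj_symm _ _ h := ⟨G.adj_symm _ _ h.1, h.2.2, h.2.1⟩
  adj_irrefl v h := G.adj_irrefl v h.1
  adj_mem _ _ h := ⟨G.adj_mem _ _ h.1, h.2.1⟩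
  arc := G.arc
  arc_symm := G.arc_symm
  arc_path _ _ h := G.arc_path _ _ h.1
  arc_verts _ _ h := fun _ hx => G.arc_verts _ _ h.1 ⟨hx.1.1, hx.2⟩
  arc_inter _ _ _ _ h h' hne := G.arc_inter _ _ _ _ h.1 h'.1 hne

/-- Deleting a set of vertices (together with all incident edges),
keeping the inherited embedding. -/
def delete (G : PlaneGraph) (X : Set (ℝ × ℝ)) : PlaneGraph := G.induce Xᶜ

/-- Deleting a single vertex. -/
def erase (G : PlaneGraph) (x : ℝ × ℝ) : PlaneGraph := G.delete {x}

/-- The point set of the plane drawing of `G`. -/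
def drawing (G : PlaneGraph) : Set (ℝ × ℝ) :=
  G.verts ∪ ⋃ (u) (v) (_ : G.Adj u v), G.arc u v

/-- The faces of `G`: connected components of the complement of the drawing. -/
def IsFace (G : PlaneGraph) (F : Set (ℝ × ℝ)) : Prop :=
  ∃ x, x ∉ G.drawing ∧ F = connectedComponentIn G.drawingᶜ x

/-- A vertex is external if it is incident to (i.e. lies on the boundary of)
an unbounded face. -/
def ExternalVertex (G : PlaneGraph) (v : ℝ × ℝ) : Prop :=
  v ∈ G.verts ∧ ∃ F, G.IsFace F ∧ ¬ Bornology.IsBounded F ∧ v ∈ closure F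

/-- A triangle (cycle on three vertices) of `G`. -/
def IsTriangle (G : PlaneGraph) (a b c : ℝ × ℝ) : Prop :=
  a ≠ b ∧ a ≠ c ∧ b ≠ c ∧ G.Adj a b ∧ G.Adj b c ∧ G.Adj a c

/-- `v` is contained in a triangle of `G`. -/
def InTriangle (G : PlaneGraph) (v : ℝ × ℝ) : Prop := ∃ b c, G.IsTriangle v b c

/-- The drawing of the closed curve formed by a triangle on `a`, `b`, `c`. -/
def triDrawing (G : PlaneGraph) (a b c : ℝ × ℝ) : Set (ℝ × ℝ) :=
  G.arc a b ∪ G.arc b c ∪ G.arc a c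

/-- A face is triangular if its boundary is the drawing of a triangle of `G`. -/
def IsTriangularFace (G : PlaneGraph) (F : Set (ℝ × ℝ)) : Prop :=
  ∃ a b c, G.IsTriangle a b c ∧ frontier F = G.triDrawing a b c

/-- The interior region of the closed curve drawn by a triangle: the union of the
bounded connected components of the complement of its drawing. -/
def triangleInterior (G : PlaneGraph) (a b c : ℝ × ℝ) : Set (ℝ × ℝ) :=
  {x | x ∉ G.triDrawing a b c ∧
    Bornology.IsBounded (connectedComponentIn (G.triDrawing a b c)ᶜ x)}

/-- A facial triangle: a triangle whose interior region is a face of `G`. -/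
def IsFacialTriangle (G : PlaneGraph) (a b c : ℝ × ℝ) : Prop :=
  G.IsTriangle a b c ∧ G.IsFace (G.triangleInterior a b c)

/-- A weak near-triangulation: every bounded face is triangular and every vertex
is contained in a triangle. -/
def IsWNT (G : PlaneGraph) : Prop :=
  (∀ F, G.IsFace F → Bornology.IsBounded F → G.IsTriangularFace F) ∧
  ∀ v ∈ G.verts, G.InTriangle v

/-- Reachability by walks in `G`. -/
def Reachable (G : PlaneGraph) (u v : ℝ × ℝ) : Prop := Relation.ReflTransGen G.Adj u v

/-- Connectedness of `G`. -/
def Connected (G : PlaneGraph) : Prop :=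
  G.verts.Nonempty ∧ ∀ u ∈ G.verts, ∀ v ∈ G.verts, G.Reachable u v

/-- A cutvertex: a vertex whose deletion separates two other vertices. -/
def IsCutvertex (G : PlaneGraph) (v : ℝ × ℝ) : Prop :=
  v ∈ G.verts ∧ ∃ a b, a ∈ G.verts ∧ b ∈ G.verts ∧ a ≠ v ∧ b ≠ v ∧
    G.Reachable a b ∧ ¬ (G.erase v).Reachable a b

/-- 2-connectivity: connected, on at least three vertices, with no cutvertex. -/
def TwoConnected (G : PlaneGraph) : Prop :=
  G.Connected ∧ 3 ≤ G.verts.ncard ∧ ∀ v, ¬ G.IsCutvertex v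

/-- A near-triangulation: a 2-connected plane graph all of whose bounded faces
are triangular. -/
def IsNearTriangulation (G : PlaneGraph) : Prop :=
  G.TwoConnected ∧ ∀ F, G.IsFace F → Bornology.IsBounded F → G.IsTriangularFace F

/-- A plane triangulation: a connected plane graph all of whose faces (including
the unbounded one) are triangular. -/
def IsTriangulation (G : PlaneGraph) : Prop :=
  G.Connected ∧ ∀ F, G.IsFace F → G.IsTriangularFace F

/-- A block of `G`, given by its vertex set `B`: a maximal set of vertices inducing
a connected subgraph without a cutvertex. -/
def IsBlock (G : PlaneGraph) (B : Set (ℝ × ℝ)) : Prop :=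
  B ⊆ G.verts ∧ (G.induce B).Connected ∧ (∀ v, ¬ (G.induce B).IsCutvertex v) ∧
  ∀ B', B ⊆ B' → B' ⊆ G.verts → (G.induce B').Connected →
    (∀ v, ¬ (G.induce B').IsCutvertex v) → B' = B

/-- A plane graph is outerplanar if all of its vertices are incident to the
unbounded face. -/
def IsOuterplanar (G : PlaneGraph) : Prop := ∀ v ∈ G.verts, G.ExternalVertex v

/-- A dominating set of `G`. -/
def IsDominatingSet (G : PlaneGraph) (D : Set (ℝ × ℝ)) : Prop :=
  D ⊆ G.verts ∧ ∀ v ∈ G.verts, v ∉ D → ∃ d ∈ D, G.Adj v d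

/-- The domination number of `G`. -/
noncomputable def dominationNumber (G : PlaneGraph) : ℕ :=
  sInf {n | ∃ D, G.IsDominatingSet D ∧ D.ncard = n}

/-- `u` is problematic in `G` if `G − u` is not a weak near-triangulation. -/
def Problematic (G : PlaneGraph) (u : ℝ × ℝ) : Prop := ¬ (G.erase u).IsWNT

/-- `x` is a `u`-bad vertex in `G`: a vertex of `G − u` not contained in a triangle
of `G − u`. -/
def IsBadFor (G : PlaneGraph) (u x : ℝ × ℝ) : Prop :=
  x ∈ G.verts ∧ x ≠ u ∧ ¬ (G.erase u).InTriangle x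

end PlaneGraph

/-- Every continuous nowhere vanishing complex function on `K` has a continuous logarithm. -/
def HasContinuousLogs {X : Type*} [TopologicalSpace X] (K : Set X) : Prop :=
  ∀ f : X → ℂ, ContinuousOn f K → (∀ z ∈ K, f z ≠ 0) →
    ∃ g : X → ℂ, ContinuousOn g K ∧ ∀ z ∈ K, Complex.exp (g z) = f z

theorem exists_continuous_log {A : Type*} [TopologicalSpace A] [SimplyConnectedSpace A]
    [LocallyPathConnectedSpace A] {f : A → ℂ} (hf : Continuous f) (h0 : ∀ a, f a ≠ 0) :
    ∃ g : A → ℂ, Continuous g ∧ ∀ a, Complex.exp (g a) = f a := by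
  obtain ⟨a₀⟩ : Nonempty A := inferInstance
  obtain ⟨F, ⟨-, hF⟩, -⟩ := Complex.isCoveringMapOn_exp.existsUnique_continuousMap_lifts
    ⟨f, hf⟩ (a₀ := a₀) (e₀ := Complex.log (f a₀)) (Complex.exp_log (h0 a₀)) h0
  exact ⟨F, F.continuous, fun a ↦ congrFun hF a⟩

/-- Two continuous logarithms of one function on a preconnected set differ by a constant. -/
theorem IsPreconnected.exists_int_of_exp_eq {X : Type*} [TopologicalSpace X] {S : Set X}
    (hS : IsPreconnected S) {f g : X → ℂ} (hf : ContinuousOn f S) (hg : ContinuousOn g S)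
    (h : ∀ z ∈ S, Complex.exp (f z) = Complex.exp (g z)) :
    ∃ n : ℤ, ∀ z ∈ S, f z = g z + n * (2 * Real.pi * Complex.I) := by
  have hdisc : IsDiscrete (AddSubgroup.zmultiples (2 * Real.pi * Complex.I) : Set ℂ) :=
    ⟨NormedSpace.discreteTopology_zmultiples _⟩
  obtain ⟨y, hy, hyS⟩ := hS.eqOn_const_of_mapsTo hdisc (hf.sub hg) (fun z hz ↦ by
    obtain ⟨n, hn⟩ := Complex.exp_eq_exp_iff_exists_int.1 (h z hz)
    exact ⟨n, by simp [hn]⟩) ⟨0, zero_mem _⟩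
  obtain ⟨n, rfl⟩ := hy
  refine ⟨n, fun z hz ↦ ?_⟩
  have := hyS hz
  simp only [Pi.sub_apply, Function.const_apply, zsmul_eq_mul] at this
  linear_combination this

theorem Complex.exp_add_int_mul_two_pi_I (z : ℂ) (n : ℤ) :
    Complex.exp (z + n * (2 * Real.pi * Complex.I)) = Complex.exp z :=
  Complex.exp_eq_exp_iff_exists_int.2 ⟨n, rfl⟩

/-- Continuous logarithms on two closed sets glue if they agree on the intersection. -/
theorem exists_log_union {X : Type*} [TopologicalSpace X] {K L : Set X} (hK : IsClosed K)
    (hL : IsClosed L) {f g₁ g₂ : X → ℂ} (h₁ : ContinuousOn g₁ K) (h₂ : ContinuousOn g₂ L)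
    (e₁ : ∀ z ∈ K, Complex.exp (g₁ z) = f z) (e₂ : ∀ z ∈ L, Complex.exp (g₂ z) = f z) (n : ℤ)
    (hn : ∀ z ∈ K ∩ L, g₁ z = g₂ z + n * (2 * Real.pi * Complex.I)) :
    ∃ g : X → ℂ, ContinuousOn g (K ∪ L) ∧ ∀ z ∈ K ∪ L, Complex.exp (g z) = f z := by
  classical
  let g : X → ℂ := fun z ↦ if z ∈ K then g₁ z else g₂ z + n * (2 * Real.pi * Complex.I)
  have hgK : EqOn g g₁ K := fun z hz ↦ if_pos hz
  have hgL : EqOn g (fun z ↦ g₂ z + n * (2 * Real.pi * Complex.I)) L := by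
    intro z hz
    by_cases hzK : z ∈ K
    · rw [hgK hzK, hn z ⟨hzK, hz⟩]
    · exact if_neg hzK
  refine ⟨g, ContinuousOn.union_of_isClosed (h₁.congr hgK)
    ((h₂.add continuousOn_const).congr hgL) hK hL, ?_⟩
  rintro z (hz | hz)
  · rw [hgK hz, e₁ z hz]
  · rw [hgL hz]
    simp only [Complex.exp_add_int_mul_two_pi_I, e₂ z hz]

theorem HasContinuousLogs.union {X : Type*} [TopologicalSpace X] {K L : Set X}
    (hK : HasContinuousLogs K) (hL : HasContinuousLogs L) (cK : IsClosed K) (cL : IsClosed L)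
    (hKL : IsPreconnected (K ∩ L)) : HasContinuousLogs (K ∪ L) := by
  intro f hf h0
  obtain ⟨g₁, c₁, e₁⟩ := hK f (hf.mono subset_union_left) fun z hz ↦ h0 z (.inl hz)
  obtain ⟨g₂, c₂, e₂⟩ := hL f (hf.mono subset_union_right) fun z hz ↦ h0 z (.inr hz)
  obtain ⟨n, hn⟩ := hKL.exists_int_of_exp_eq (c₁.mono inter_subset_left)
    (c₂.mono inter_subset_right) fun z hz ↦ (e₁ z hz.1).trans (e₂ z hz.2).symm
  exact exists_log_union cK cL c₁ c₂ e₁ e₂ n hn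

/-- An injective path has a continuous inverse on its range. -/
theorem Path.exists_continuousOn_leftInverse {X : Type*} [TopologicalSpace X] [T2Space X]
    {p q : X} (γ : Path p q) (hγ : Function.Injective γ) :
    ∃ σ : X → ℝ, ContinuousOn σ (range γ) ∧ ∀ t ∈ Icc (0 : ℝ) 1, σ (γ.extend t) = t := by
  classical
  have emb : Topology.IsEmbedding γ := (γ.continuous.isClosedEmbedding hγ).isEmbedding
  let e := emb.toHomeomorph
  refine ⟨fun x ↦ if h : x ∈ range γ then (e.symm ⟨x, h⟩ : ℝ) else 0, ?_, fun t ht ↦ ?_⟩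
  · rw [continuousOn_iff_continuous_domRestrict]
    have : (range γ).domRestrict (fun x ↦ if h : x ∈ range γ then (e.symm ⟨x, h⟩ : ℝ) else 0)
        = fun x ↦ (e.symm x : ℝ) := by
      ext ⟨x, hx⟩
      exact dif_pos hx
    rw [this]
    exact continuous_subtype_val.comp e.symm.continuous
  · have h : γ.extend t ∈ range γ := by rw [← γ.extend_range]; exact mem_range_self t
    refine (dif_pos h).trans ?_
    have : (⟨γ.extend t, h⟩ : range γ) = e ⟨t, ht⟩ := Subtype.ext (γ.extend_apply ht)
    rw [this, e.symm_apply_apply]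

theorem Path.extend_mem_range {X : Type*} [TopologicalSpace X] {p q : X} (γ : Path p q) (t : ℝ) :
    γ.extend t ∈ range γ := by
  rw [← γ.extend_range]; exact mem_range_self t

theorem Path.extend_injOn {X : Type*} [TopologicalSpace X] {p q : X} {γ : Path p q}
    (hγ : Function.Injective γ) : InjOn γ.extend (Icc 0 1) := by
  intro s hs t ht h
  rw [γ.extend_apply hs, γ.extend_apply ht] at h
  exact congrArg Subtype.val (hγ h)

theorem Path.image_extend_Icc {X : Type*} [TopologicalSpace X] {p q : X} (γ : Path p q) :
    γ.extend '' Icc 0 1 = range γ := by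
  ext x
  constructor
  · rintro ⟨t, -, rfl⟩
    exact γ.extend_mem_range t
  · rintro ⟨t, rfl⟩
    exact ⟨t, t.2, γ.extend_apply t.2⟩

theorem Path.hasContinuousLogs_image {X : Type*} [TopologicalSpace X] [T2Space X] {p q : X}
    (γ : Path p q) (hγ : Function.Injective γ) {s t : ℝ} (hs : 0 ≤ s) (hst : s ≤ t) (ht : t ≤ 1) :
    HasContinuousLogs (γ.extend '' Icc s t) := by
  intro f hf h0
  have hm : ∀ r : ℝ, γ.extend (projIcc s t hst r) ∈ γ.extend '' Icc s t := fun r ↦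
    mem_image_of_mem _ (projIcc s t hst r).2
  have hc : Continuous fun r : ℝ ↦ f (γ.extend (projIcc s t hst r)) :=
    hf.comp_continuous (γ.continuous_extend.comp
      (continuous_subtype_val.comp continuous_projIcc)) hm
  obtain ⟨G, cG, eG⟩ := exists_continuous_log hc fun r ↦ h0 _ (hm r)
  obtain ⟨σ, cσ, hσ⟩ := γ.exists_continuousOn_leftInverse hγ
  refine ⟨G ∘ σ, cG.comp_continuousOn (cσ.mono ?_), ?_⟩
  · rintro _ ⟨r, -, rfl⟩
    exact γ.extend_mem_range r
  · rintro _ ⟨r, hr, rfl⟩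
    simp only [Function.comp_apply]
    rw [hσ r ⟨hs.trans hr.1, hr.2.trans ht⟩, eG, projIcc_of_mem hst hr]

theorem Path.hasContinuousLogs_range {X : Type*} [TopologicalSpace X] [T2Space X] {p q : X}
    (γ : Path p q) (hγ : Function.Injective γ) : HasContinuousLogs (range γ) := by
  rw [← γ.image_extend_Icc]
  exact γ.hasContinuousLogs_image hγ le_rfl zero_le_one le_rfl

/-- A nonzero power of `z - a` has no continuous logarithm on a circle around `a`. -/
theorem eq_zero_of_exp_eq_zpow_on_sphere {a : ℂ} {r : ℝ} (hr : 0 < r) {m : ℤ} {g : ℂ → ℂ}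
    (hg : ContinuousOn g (Metric.sphere a r))
    (h : ∀ z ∈ Metric.sphere a r, Complex.exp (g z) = (z - a) ^ m) : m = 0 := by
  let c : ℝ → ℂ := circleMap a r
  have hc : ∀ θ, c θ ∈ Metric.sphere a r := circleMap_mem_sphere a hr.le
  have hr' : (r : ℂ) ≠ 0 := by exact_mod_cast hr.ne'
  obtain ⟨n, hn⟩ := isPreconnected_univ.exists_int_of_exp_eq (X := ℝ)
    (f := fun θ ↦ g (c θ)) (g := fun θ ↦ m * (Complex.log r + θ * Complex.I))
    (hg.comp_continuous (continuous_circleMap a r) hc).continuousOn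
    (by fun_prop) (fun θ _ ↦ by
      rw [h _ (hc θ), Complex.exp_int_mul, Complex.exp_add, Complex.exp_log hr']
      simp [c, circleMap])
  have h0 := hn 0 trivial
  have h1 := hn (2 * Real.pi) trivial
  have hcc : c (2 * Real.pi) = c 0 := by simp [c, circleMap]
  simp only [hcc] at h1
  have h2 : (m : ℂ) * (2 * Real.pi * Complex.I) = 0 := by
    push_cast at h1 h0
    linear_combination h1.symm.trans h0
  have := Complex.two_pi_I_ne_zero
  have h3 : (m : ℂ) = 0 := (mul_eq_zero.1 h2).resolve_right this
  exact_mod_cast h3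

theorem closure_connectedComponentIn_compl_subset {X : Type*} [TopologicalSpace X] {K : Set X}
    (x : X) : closure (connectedComponentIn Kᶜ x) ⊆ connectedComponentIn Kᶜ x ∪ K := by
  intro z hz
  by_cases hzK : z ∈ K
  · exact .inr hzK
  left
  by_cases hx : x ∈ Kᶜ
  · have hpre : IsPreconnected (insert z (connectedComponentIn Kᶜ x)) :=
      isPreconnected_connectedComponentIn.subset_closure (subset_insert _ _)
        (insert_subset hz subset_closure)
    exact hpre.subset_connectedComponentIn (mem_insert_of_mem _ (mem_connectedComponentIn hx))
      (insert_subset hzK (connectedComponentIn_subset _ _)) (mem_insert _ _)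
  · rw [connectedComponentIn_eq_empty hx, closure_empty] at hz
    exact hz.elim

/-- If `(z - a) ^ m * (z - b) ^ n` has a continuous logarithm on the closed set `K` and `b` lies
neither in `K` nor in the bounded component of the complement of `K` around `a`, then `m = 0`. -/
theorem eq_zero_of_exp_eq_on_of_isBounded {K : Set ℂ} (hK : IsClosed K) {a b : ℂ} (ha : a ∉ K)
    (hb : b ∉ K) (hU : Bornology.IsBounded (connectedComponentIn Kᶜ a))
    (hbU : b ∉ connectedComponentIn Kᶜ a) {m n : ℤ} {g : ℂ → ℂ} (hg : ContinuousOn g K)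
    (h : ∀ z ∈ K, Complex.exp (g z) = (z - a) ^ m * (z - b) ^ n) : m = 0 := by
  classical
  set U := connectedComponentIn Kᶜ a with hUdef
  have hUo : IsOpen U := hK.isOpen_compl.connectedComponentIn
  have haU : a ∈ U := mem_connectedComponentIn ha
  have hcl : closure U ⊆ U ∪ K := closure_connectedComponentIn_compl_subset a
  have hUK : U ⊆ Kᶜ := connectedComponentIn_subset _ _
  have hbc : b ∉ closure U := fun hbc ↦ (hcl hbc).elim hbU hb
  obtain ⟨G, hG⟩ := ContinuousMap.exists_restrict_eq hK ⟨K.domRestrict g, hg.domRestrict⟩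
  have hGg : ∀ z ∈ K, G z = g z := fun z hz ↦ congrArg (fun F ↦ F ⟨z, hz⟩) hG
  have hfr : frontier (closure U) ⊆ K := by
    intro z hz
    have h1 : z ∈ closure U := closure_closure (s := U) ▸ hz.1
    refine (hcl h1).resolve_left fun hzU ↦ hz.2 ?_
    exact interior_maximal subset_closure hUo hzU
  let f : ℂ → ℂ := (closure U).piecewise (fun z ↦ Complex.exp (G z) * (z - b) ^ (-n))
    fun z ↦ (z - a) ^ m
  have hf : Continuous f := by
    have hf' : ContinuousOn f univ := by
      refine ContinuousOn.piecewise ?_ ?_ ?_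
      · rintro z ⟨-, hz⟩
        have hzK := hfr hz
        have hzb : z - b ≠ 0 := sub_ne_zero.2 fun e ↦ hb (e ▸ hzK)
        rw [hGg z hzK, h z hzK, mul_assoc, ← zpow_add₀ hzb]
        simp
      · rw [univ_inter, closure_closure]
        intro z hz
        have hzb : z - b ≠ 0 := sub_ne_zero.2 fun e ↦ hbc (e ▸ hz)
        exact (((Complex.continuous_exp.comp G.continuous).continuousAt).mul
          ((continuousAt_id.sub continuousAt_const).zpow₀ _ (.inl hzb))).continuousWithinAt
      · intro z hz
        have hza : z - a ≠ 0 := sub_ne_zero.2 fun e ↦ by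
          rw [univ_inter, closure_compl] at hz
          exact hz (interior_maximal subset_closure hUo (e ▸ haU))
        exact ((continuousAt_id.sub continuousAt_const).zpow₀ _ (.inl hza)).continuousWithinAt
    rwa [continuousOn_univ] at hf'
  have hf0 : ∀ z, f z ≠ 0 := by
    intro z
    by_cases hz : z ∈ closure U
    · simp only [f, piecewise_eq_of_mem _ _ _ hz]
      exact mul_ne_zero (Complex.exp_ne_zero _)
        (zpow_ne_zero _ (sub_ne_zero.2 fun e ↦ hbc (e ▸ hz)))
    · simp only [f, piecewise_eq_of_notMem _ _ _ hz]
      exact zpow_ne_zero _ (sub_ne_zero.2 fun e ↦ hz (subset_closure (e ▸ haU)))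
  obtain ⟨l, hl, hlf⟩ := exists_continuous_log hf hf0
  obtain ⟨R, hR0, hR⟩ := hU.closure.subset_ball_lt 0 a
  refine eq_zero_of_exp_eq_zpow_on_sphere (a := a) hR0 hl.continuousOn fun z hz ↦ ?_
  rw [hlf]
  refine piecewise_eq_of_notMem _ _ _ fun hzU ↦ ?_
  have := hR hzU
  rw [Metric.mem_ball] at this
  exact this.ne hz

theorem isPreconnected_compl_closedBall_zero {R : ℝ} (hR : 0 < R) :
    IsPreconnected (Metric.closedBall (0 : ℂ) R)ᶜ := by
  have : (Metric.closedBall (0 : ℂ) R)ᶜ = Complex.exp '' {w | Real.log R < w.re} := by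
    ext z
    simp only [mem_compl_iff, Metric.mem_closedBall, dist_zero_right, not_le, mem_image,
      mem_ofPred_eq]
    constructor
    · intro hz
      have hz0 : z ≠ 0 := norm_pos_iff.1 (hR.trans hz)
      refine ⟨Complex.log z, ?_, Complex.exp_log hz0⟩
      rw [Complex.log_re]
      exact Real.log_lt_log hR hz
    · rintro ⟨w, hw, rfl⟩
      rwa [Complex.norm_exp, ← Real.log_lt_iff_lt_exp hR]
  rw [this]
  exact (convex_halfSpace_re_gt _).isPreconnected.image _ Complex.continuous_exp.continuousOn

/-- The complement of a bounded closed set has exactly one unbounded component. -/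
theorem exists_unbounded_connectedComponentIn {K : Set ℂ} (hK : IsCompact K) :
    ∃ w ∉ K, ¬ Bornology.IsBounded (connectedComponentIn Kᶜ w) ∧
      ∀ z ∉ K, z ∉ connectedComponentIn Kᶜ w → Bornology.IsBounded (connectedComponentIn Kᶜ z) := by
  obtain ⟨R, hR0, hR⟩ := hK.isBounded.subset_closedBall_lt 0 0
  have hE := isPreconnected_compl_closedBall_zero hR0
  have hEK : (Metric.closedBall (0 : ℂ) R)ᶜ ⊆ Kᶜ := compl_subset_compl.2 hR
  have hEu : ¬ Bornology.IsBounded (Metric.closedBall (0 : ℂ) R)ᶜ := fun h ↦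
    NormedSpace.unbounded_univ ℂ ℂ (by
      have := h.union (Metric.isBounded_closedBall (x := (0 : ℂ)) (r := R))
      rwa [compl_union_self] at this)
  obtain ⟨w, hw⟩ : (Metric.closedBall (0 : ℂ) R)ᶜ.Nonempty := by
    rw [nonempty_iff_ne_empty]
    intro h
    exact hEu (h ▸ Bornology.isBounded_empty)
  have hsub := hE.subset_connectedComponentIn hw hEK
  refine ⟨w, hEK hw, fun h ↦ hEu (h.subset hsub), fun z hz hzw ↦ ?_⟩
  refine (Metric.isBounded_closedBall (x := (0 : ℂ)) (r := R)).subset fun y hy ↦ ?_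
  by_contra hyE
  have h1 := connectedComponentIn_eq hy
  have h2 := connectedComponentIn_eq (hsub hyE)
  exact hzw (by rw [h2, ← h1]; exact mem_connectedComponentIn hz)

/-- A compact set with continuous logarithms does not separate the plane. -/
theorem HasContinuousLogs.isPreconnected_compl {K : Set ℂ} (h : HasContinuousLogs K)
    (hK : IsCompact K) : IsPreconnected Kᶜ := by
  obtain ⟨w, hw, hwu, hb⟩ := exists_unbounded_connectedComponentIn hK
  have : Kᶜ = connectedComponentIn Kᶜ w := by
    refine Subset.antisymm (fun a ha ↦ ?_) (connectedComponentIn_subset _ _)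
    by_contra haw
    have hU := hb a ha haw
    obtain ⟨g, hg, hge⟩ := h (fun z ↦ z - a) (by fun_prop)
      fun z hz ↦ sub_ne_zero.2 fun e ↦ ha (e ▸ hz)
    have hwa : w ∉ connectedComponentIn Kᶜ a := fun hwa ↦ haw
      (connectedComponentIn_eq hwa ▸ mem_connectedComponentIn ha)
    exact one_ne_zero (eq_zero_of_exp_eq_on_of_isBounded hK.isClosed ha hw hU hwa
      (m := 1) (n := 0) hg (by simpa using hge))
  rw [this]
  exact isPreconnected_connectedComponentIn

/-- If `K` and `L` have continuous logarithms and meet in at most two points, then the complement of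
`K ∪ L` has at most one bounded component. -/
theorem mem_connectedComponentIn_of_isBounded {K L : Set ℂ} {p q : ℂ} (hK : HasContinuousLogs K)
    (hL : HasContinuousLogs L) (cK : IsClosed K) (cL : IsClosed L) (hKL : K ∩ L = {p, q})
    {a b : ℂ} (ha : a ∉ K ∪ L) (hb : b ∉ K ∪ L)
    (haU : Bornology.IsBounded (connectedComponentIn (K ∪ L)ᶜ a))
    (hbU : Bornology.IsBounded (connectedComponentIn (K ∪ L)ᶜ b)) :
    b ∈ connectedComponentIn (K ∪ L)ᶜ a := by
  by_contra hba
  have hab : a ∉ connectedComponentIn (K ∪ L)ᶜ b := fun hab ↦ hba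
    (connectedComponentIn_eq hab ▸ mem_connectedComponentIn hb)
  have hp : p ∈ K ∩ L := hKL ▸ mem_insert _ _
  have hq : q ∈ K ∩ L := hKL ▸ mem_insert_of_mem _ rfl
  have key : ∀ c ∉ K ∪ L, ∃ g₁ g₂ : ℂ → ℂ, ContinuousOn g₁ K ∧ ContinuousOn g₂ L ∧
      (∀ z ∈ K, Complex.exp (g₁ z) = z - c) ∧ (∀ z ∈ L, Complex.exp (g₂ z) = z - c) ∧
      ∃ n : ℤ, g₁ p = g₂ p ∧ g₁ q = g₂ q + n * (2 * Real.pi * Complex.I) := by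
    intro c hc
    obtain ⟨g₁, hg₁, e₁⟩ := hK (fun z ↦ z - c) (by fun_prop)
      fun z hz ↦ sub_ne_zero.2 fun e ↦ hc (e ▸ .inl hz)
    obtain ⟨g₂, hg₂, e₂⟩ := hL (fun z ↦ z - c) (by fun_prop)
      fun z hz ↦ sub_ne_zero.2 fun e ↦ hc (e ▸ .inr hz)
    obtain ⟨i, hi⟩ := Complex.exp_eq_exp_iff_exists_int.1 ((e₁ p hp.1).trans (e₂ p hp.2).symm)
    obtain ⟨j, hj⟩ := Complex.exp_eq_exp_iff_exists_int.1 ((e₁ q hq.1).trans (e₂ q hq.2).symm)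
    refine ⟨g₁, fun z ↦ g₂ z + i * (2 * Real.pi * Complex.I), hg₁,
      hg₂.add continuousOn_const, e₁, fun z hz ↦ ?_, j - i, hi, ?_⟩
    · rw [Complex.exp_add_int_mul_two_pi_I, e₂ z hz]
    · push_cast
      rw [hj]
      ring
  obtain ⟨g₁, g₂, cg₁, cg₂, e₁, e₂, n, hgp, hgq⟩ := key a ha
  obtain ⟨k₁, k₂, ck₁, ck₂, d₁, d₂, m, hkp, hkq⟩ := key b hb
  have cKL := cK.union cL
  have comb : ∀ i j : ℤ, i * n + j * m = 0 → ∃ g : ℂ → ℂ, ContinuousOn g (K ∪ L) ∧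
      ∀ z ∈ K ∪ L, Complex.exp (g z) = (z - a) ^ i * (z - b) ^ j := by
    intro i j hij
    refine exists_log_union (g₁ := fun z ↦ i * g₁ z + j * k₁ z)
      (g₂ := fun z ↦ i * g₂ z + j * k₂ z) cK cL
      ((continuousOn_const.mul cg₁).add (continuousOn_const.mul ck₁))
      ((continuousOn_const.mul cg₂).add (continuousOn_const.mul ck₂))
      (fun z hz ↦ ?_) (fun z hz ↦ ?_) 0 fun z hz ↦ ?_
    · rw [Complex.exp_add, Complex.exp_int_mul, Complex.exp_int_mul, e₁ z hz, d₁ z hz]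
    · rw [Complex.exp_add, Complex.exp_int_mul, Complex.exp_int_mul, e₂ z hz, d₂ z hz]
    · rw [hKL] at hz
      rcases hz with rfl | rfl
      · rw [hgp, hkp]
        simp
      · have : (i * n + j * m : ℂ) = 0 := by exact_mod_cast hij
        rw [hgq, hkq]
        push_cast
        linear_combination this * (2 * Real.pi * Complex.I)
  obtain ⟨g, cg, eg⟩ := comb m (-n) (by ring)
  have hm : m = 0 := eq_zero_of_exp_eq_on_of_isBounded cKL ha hb haU hba cg eg
  have hn : -n = 0 := eq_zero_of_exp_eq_on_of_isBounded cKL hb ha hbU hab cg fun z hz ↦ by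
    rw [eg z hz, mul_comm]
  have hn' : n = 0 := by omega
  obtain ⟨g', cg', egn⟩ := comb 1 0 (by simp [hn'])
  exact one_ne_zero (eq_zero_of_exp_eq_on_of_isBounded cKL ha hb haU hba cg' egn)

/-- Off the image of a path from `p` to `q`, the function `(z - q) / (z - p)` has a continuous
logarithm. -/
theorem Path.exists_log_div {p q : ℂ} (γ : Path p q) :
    ∃ g : ℂ → ℂ, ContinuousOn g (range γ)ᶜ ∧
      ∀ z ∈ (range γ)ᶜ, Complex.exp (g z) = (z - q) / (z - p) := by
  classical
  have hne : ∀ (t : unitInterval) (z : ↥(range γ)ᶜ), (z : ℂ) - γ t ≠ 0 := fun t z ↦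
    sub_ne_zero.2 fun e ↦ z.2 ⟨t, e.symm⟩
  let H : C(unitInterval × ↥(range γ)ᶜ, {z : ℂ // z ≠ 0}) :=
    ⟨fun x ↦ ⟨((x.2 : ℂ) - γ x.1) / ((x.2 : ℂ) - γ 0), div_ne_zero (hne _ _) (hne _ _)⟩, by
      refine Continuous.subtype_mk (Continuous.div (by fun_prop) (by fun_prop) ?_) _
      exact fun x ↦ hne _ _⟩
  let F := Complex.isCoveringMap_exp.liftHomotopy H (.const _ 0) fun z ↦ by
    refine Subtype.ext ?_
    simp only [H, ContinuousMap.coe_mk, ContinuousMap.const_apply, Complex.exp_zero]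
    exact div_self (hne 0 z)
  have hF : ∀ x, Complex.exp (F x) = ((x.2 : ℂ) - γ x.1) / ((x.2 : ℂ) - γ 0) := fun x ↦
    congrArg Subtype.val (congrFun (Complex.isCoveringMap_exp.liftHomotopy_lifts H _ _) x)
  refine ⟨fun z ↦ if h : z ∈ (range γ)ᶜ then F (1, ⟨z, h⟩) else 0, ?_, fun z hz ↦ ?_⟩
  · rw [continuousOn_iff_continuous_domRestrict]
    have : (range γ)ᶜ.domRestrict (fun z ↦ if h : z ∈ (range γ)ᶜ then F (1, ⟨z, h⟩) else 0)
        = fun z ↦ F (1, z) := by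
      ext z
      exact dif_pos z.2
    rw [this]
    fun_prop
  · simp only [dif_pos hz, hF, γ.source, γ.target]

/-- Two paths between distinct points `p`, `q` meeting only in `p` and `q` together separate the
plane. -/
theorem not_isPreconnected_compl_union {p q : ℂ} (hpq : p ≠ q) (γ δ : Path p q)
    (h : range γ ∩ range δ = {p, q}) : ¬ IsPreconnected (range γ ∪ range δ)ᶜ := by
  classical
  intro hc
  have cγ : IsClosed (range γ) := (isCompact_range γ.continuous).isClosed
  have cδ : IsClosed (range δ) := (isCompact_range δ.continuous).isClosed
  obtain ⟨g₁, hg₁, e₁⟩ := γ.exists_log_div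
  obtain ⟨g₂, hg₂, e₂⟩ := δ.exists_log_div
  rw [compl_union] at hc
  obtain ⟨n, hn⟩ := hc.exists_int_of_exp_eq (hg₁.mono inter_subset_left)
    (hg₂.mono inter_subset_right) fun z hz ↦ (e₁ z hz.1).trans (e₂ z hz.2).symm
  let g : ℂ → ℂ := fun z ↦ if z ∈ range γ then g₂ z + n * (2 * Real.pi * Complex.I) else g₁ z
  have hgγ : EqOn g g₁ (range γ)ᶜ := fun z hz ↦ if_neg hz
  have hgδ : EqOn g (fun z ↦ g₂ z + n * (2 * Real.pi * Complex.I)) (range δ)ᶜ := by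
    intro z hz
    by_cases hzγ : z ∈ range γ
    · exact if_pos hzγ
    · rw [hgγ hzγ, hn z ⟨hzγ, hz⟩]
  have hun : (range γ)ᶜ ∪ (range δ)ᶜ = {p, q}ᶜ := by rw [← compl_inter, h]
  have hg : ContinuousOn g {p, q}ᶜ := by
    rw [← hun]
    exact (hg₁.congr hgγ).union_of_isOpen ((hg₂.add continuousOn_const).congr hgδ)
      cγ.isOpen_compl cδ.isOpen_compl
  have hge : ∀ z ∈ ({p, q}ᶜ : Set ℂ), Complex.exp (g z) = (z - q) / (z - p) := by
    rw [← hun]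
    rintro z (hz | hz)
    · rw [hgγ hz, e₁ z hz]
    · rw [hgδ hz, ← e₂ z hz]
      exact Complex.exp_add_int_mul_two_pi_I _ _
  have hd : 0 < dist p q := dist_pos.2 hpq
  have hqp : p - q ≠ 0 := sub_ne_zero.2 hpq
  have hr : 0 < dist p q / 2 := half_pos hd
  have hS : Metric.sphere p (dist p q / 2) ⊆ {p, q}ᶜ := by
    intro z hz
    rw [mem_compl_iff, mem_insert_iff, mem_singleton_iff, not_or]
    rw [Metric.mem_sphere] at hz
    constructor
    · rintro rfl
      rw [dist_self] at hz
      exact hr.ne hz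
    · rintro rfl
      rw [dist_comm] at hz
      linarith
  have hslit : ∀ z ∈ Metric.sphere p (dist p q / 2), (z - q) / (p - q) ∈ Complex.slitPlane := by
    intro z hz
    have : (z - q) / (p - q) = 1 + (z - p) / (p - q) := by field_simp; ring
    rw [this]
    refine Complex.mem_slitPlane_of_norm_lt_one ?_
    rw [norm_div, ← dist_eq_norm, ← dist_eq_norm, Metric.mem_sphere.1 hz, div_lt_one hd]
    linarith
  refine one_ne_zero (α := ℤ) (neg_eq_zero.1 (eq_zero_of_exp_eq_zpow_on_sphere (a := p) hr
    (g := fun z ↦ g z - Complex.log ((z - q) / (p - q)) - Complex.log (p - q)) ?_ ?_))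
  · refine ((hg.mono hS).sub (ContinuousOn.clog ?_ hslit)).sub continuousOn_const
    fun_prop
  · intro z hz
    have h1 : z - q ≠ 0 := sub_ne_zero.2 fun e ↦ hS hz (by simp [e])
    have h2 : z - p ≠ 0 := sub_ne_zero.2 fun e ↦ hS hz (by simp [e])
    rw [Complex.exp_sub, Complex.exp_sub, hge z (hS hz), Complex.exp_log hqp,
      Complex.exp_log (div_ne_zero h1 hqp)]
    simp only [zpow_neg, zpow_one]
    field_simp

/-- If an arc `γ` from `a` to `b` and a compact set `B` with continuous logarithms meet exactly in
`a` and `b`, then every component of the complement of their union accumulates at all of `γ`. -/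
theorem Path.range_subset_closure {a b : ℂ} (γ : Path a b) (hγ : Function.Injective γ) {B : Set ℂ}
    (hB : IsCompact B) (lB : HasContinuousLogs B) (hγB : range γ ∩ B = {a, b}) {U : Set ℂ}
    (hUo : IsOpen U) (hUn : U.Nonempty) (hU : U ⊆ (range γ ∪ B)ᶜ)
    (hUc : closure U ⊆ U ∪ (range γ ∪ B)) : range γ ⊆ closure U := by
  have inj := Path.extend_injOn hγ
  have ha : a ∈ B := (hγB.symm ▸ mem_insert a _ : a ∈ range γ ∩ B).2
  have hb : b ∈ B := (hγB.symm ▸ mem_insert_of_mem a rfl : b ∈ range γ ∩ B).2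
  have hend : ∀ t ∈ Icc (0 : ℝ) 1, γ.extend t ∈ B → t = 0 ∨ t = 1 := by
    intro t ht htB
    have : γ.extend t ∈ ({a, b} : Set ℂ) := hγB ▸ ⟨γ.extend_mem_range t, htB⟩
    rcases this with h | h
    · exact .inl (inj ht ⟨le_rfl, zero_le_one⟩ (h.trans γ.extend_zero.symm))
    · exact .inr (inj ht ⟨zero_le_one, le_rfl⟩ (h.trans γ.extend_one.symm))
  have hIoo : γ.extend '' Ioo 0 1 ⊆ closure U := by
    rintro _ ⟨t, ht, rfl⟩
    by_contra hr
    have hVn : γ.extend ⁻¹' (closure U)ᶜ ∈ nhds t :=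
      (isClosed_closure.isOpen_compl.preimage γ.continuous_extend).mem_nhds hr
    obtain ⟨ε, hε, hεV⟩ := Metric.mem_nhds_iff.1 hVn
    obtain ⟨s, hs⟩ := exists_between (max_lt ht.1 (sub_lt_self t hε))
    obtain ⟨s', hs'⟩ := exists_between (lt_min ht.2 (lt_add_of_pos_right t hε))
    rw [max_lt_iff] at hs
    rw [lt_min_iff] at hs'
    have hV : ∀ r ∈ Icc s s', γ.extend r ∉ closure U := fun r hr ↦ hεV (by
      rw [Metric.mem_ball, Real.dist_eq, abs_lt]
      constructor <;> linarith [hr.1, hr.2])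
    have cI : ∀ x y : ℝ, IsCompact (γ.extend '' Icc x y) := fun x y ↦
      isCompact_Icc.image γ.continuous_extend
    have lD : HasContinuousLogs (γ.extend '' Icc 0 s ∪ B) := by
      refine (γ.hasContinuousLogs_image hγ le_rfl hs.1.1.le (hs.2.trans ht.2).le).union lB
        (cI _ _).isClosed hB.isClosed (Set.Subsingleton.isPreconnected ?_)
      have : ∀ z ∈ γ.extend '' Icc 0 s ∩ B, z = γ.extend 0 := by
        rintro _ ⟨⟨r, hr, rfl⟩, hrB⟩
        rcases hend r ⟨hr.1, by linarith [hr.2, ht.2]⟩ hrB with rfl | rfl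
        · rfl
        · linarith [hr.2, ht.2]
      exact fun x hx y hy ↦ (this x hx).trans (this y hy).symm
    have lC : HasContinuousLogs (γ.extend '' Icc 0 s ∪ B ∪ γ.extend '' Icc s' 1) := by
      refine lD.union (γ.hasContinuousLogs_image hγ (ht.1.trans hs'.1).le hs'.2.1.le le_rfl)
        ((cI _ _).union hB).isClosed (cI _ _).isClosed (Set.Subsingleton.isPreconnected ?_)
      have : ∀ z ∈ (γ.extend '' Icc 0 s ∪ B) ∩ γ.extend '' Icc s' 1, z = γ.extend 1 := by
        rintro _ ⟨h, ⟨r, hr, rfl⟩⟩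
        have hr01 : r ∈ Icc (0 : ℝ) 1 := ⟨by linarith [hr.1, ht.1], hr.2⟩
        rcases h with ⟨r', hr', e⟩ | h
        · have := inj ⟨hr'.1, by linarith [hr'.2, ht.2]⟩ hr01 e
          linarith [hr'.2, hr.1]
        · rcases hend r hr01 h with rfl | rfl
          · linarith [hr.1, ht.1]
          · rfl
      exact fun x hx y hy ↦ (this x hx).trans (this y hy).symm
    set C := γ.extend '' Icc 0 s ∪ B ∪ γ.extend '' Icc s' 1
    have hCsub : C ⊆ range γ ∪ B := by
      rintro _ ((⟨r, -, rfl⟩ | h) | ⟨r, -, rfl⟩)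
      · exact .inl (γ.extend_mem_range r)
      · exact .inr h
      · exact .inl (γ.extend_mem_range r)
    have hCp := lC.isPreconnected_compl (((cI _ _).union hB).union (cI _ _))
    have hsub : Cᶜ ⊆ U := by
      refine hCp.subset_of_closure_inter_subset hUo ?_ ?_
      · obtain ⟨z, hz⟩ := hUn
        exact ⟨z, fun h ↦ hU hz (hCsub h), hz⟩
      · rintro z ⟨hz, hzC⟩
        rcases hUc hz with h | h | h
        · exact h
        · rw [← γ.image_extend_Icc] at h
          obtain ⟨r, hr, rfl⟩ := h
          exfalso
          rcases le_total r s with h | h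
          · exact hzC (.inl (.inl ⟨r, ⟨hr.1, h⟩, rfl⟩))
          rcases le_total s' r with h' | h'
          · exact hzC (.inr ⟨r, ⟨h', hr.2⟩, rfl⟩)
          exact hV r ⟨h, h'⟩ hz
        · exact (hzC (.inl (.inr h))).elim
    have ht01 : t ∈ Icc (0 : ℝ) 1 := ⟨ht.1.le, ht.2.le⟩
    refine hU (hsub (a := γ.extend t) ?_) (.inl (γ.extend_mem_range t))
    rintro ((⟨r, hr, e⟩ | h) | ⟨r, hr, e⟩)
    · have := inj ⟨hr.1, by linarith [hr.2, ht.2]⟩ ht01 e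
      linarith [hr.2]
    · rcases hend t ht01 h with rfl | rfl
      · exact lt_irrefl _ ht.1
      · exact lt_irrefl _ ht.2
    · have := inj ⟨by linarith [hr.1, ht.1], hr.2⟩ ht01 e
      linarith [hr.1]
  calc range γ = γ.extend '' closure (Ioo 0 1) := by
        rw [closure_Ioo zero_ne_one, γ.image_extend_Icc]
    _ ⊆ closure (γ.extend '' Ioo 0 1) := image_closure_subset_closure_image γ.continuous_extend
    _ ⊆ closure U := closure_minimal hIoo isClosed_closure

/-- `U` and `W` are the interior and the exterior of the closed curve `J`. -/
structure IsJordanPair {E : Type*} [TopologicalSpace E] [Bornology E] (J U W : Set E) :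
    Prop where
  isOpen_left : IsOpen U
  isOpen_right : IsOpen W
  isConnected_left : IsConnected U
  isConnected_right : IsConnected W
  isBounded_left : Bornology.IsBounded U
  not_isBounded_right : ¬ Bornology.IsBounded W
  disjoint : Disjoint U W
  union_eq : U ∪ W = Jᶜ
  subset_closure_left : J ⊆ closure U
  subset_closure_right : J ⊆ closure W

theorem Path.range_triangle_inter {X : Type*} [TopologicalSpace X] {a b c : X} (α : Path a b)
    (β : Path b c) (δ : Path a c) (hαβ : range α ∩ range β = {b})
    (hαδ : range α ∩ range δ = {a}) :
    range α ∩ (range β ∪ range δ) = {a, b} := by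
  rw [inter_union_distrib_left, hαβ, hαδ, union_comm]
  rfl

/-- The **Jordan curve theorem** for a closed curve composed of three arcs. -/
theorem exists_isJordanPair {a b c : ℂ} (α : Path a b) (β : Path b c) (δ : Path a c)
    (hα : Function.Injective α) (hβ : Function.Injective β) (hδ : Function.Injective δ)
    (hαβ : range α ∩ range β = {b}) (hβδ : range β ∩ range δ = {c})
    (hαδ : range α ∩ range δ = {a}) :
    ∃ U W, IsJordanPair (range α ∪ range β ∪ range δ) U W := by
  have cα := isCompact_range α.continuous
  have cβ := isCompact_range β.continuous
  have cδ := isCompact_range δ.continuous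
  have lα := α.hasContinuousLogs_range hα
  have lβ := β.hasContinuousLogs_range hβ
  have lδ := δ.hasContinuousLogs_range hδ
  have hab : a ≠ b := fun e ↦ zero_ne_one (hα ((α.source.trans e).trans α.target.symm))
  have iα := Path.range_triangle_inter α β δ hαβ hαδ
  have iβ : range β ∩ (range α ∪ range δ) = {b, c} := by
    rw [inter_union_distrib_left, inter_comm, hαβ, hβδ]
    rfl
  have iδ : range δ ∩ (range α ∪ range β) = {a, c} := by
    rw [inter_union_distrib_left, inter_comm, hαδ, inter_comm, hβδ]
    rfl
  have lβδ : HasContinuousLogs (range β ∪ range δ) :=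
    lβ.union lδ cβ.isClosed cδ.isClosed (hβδ ▸ isPreconnected_singleton)
  have lαδ : HasContinuousLogs (range α ∪ range δ) :=
    lα.union lδ cα.isClosed cδ.isClosed (hαδ ▸ isPreconnected_singleton)
  have lαβ : HasContinuousLogs (range α ∪ range β) :=
    lα.union lβ cα.isClosed cβ.isClosed (hαβ ▸ isPreconnected_singleton)
  set J := range α ∪ range β ∪ range δ with hJ
  have hJα : range α ∪ (range β ∪ range δ) = J := (union_assoc _ _ _).symm
  have hJβ : range β ∪ (range α ∪ range δ) = J := by rw [hJ]; ac_rfl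
  have hJδ : range δ ∪ (range α ∪ range β) = J := union_comm _ _
  have cJ : IsCompact J := (cα.union cβ).union cδ
  have hclos : ∀ z ∉ J, J ⊆ closure (connectedComponentIn Jᶜ z) := by
    intro z hz
    have ho : IsOpen (connectedComponentIn Jᶜ z) := cJ.isClosed.isOpen_compl.connectedComponentIn
    have hn : (connectedComponentIn Jᶜ z).Nonempty := ⟨z, mem_connectedComponentIn hz⟩
    have hs := connectedComponentIn_subset Jᶜ z
    have hc := closure_connectedComponentIn_compl_subset (K := J) z
    refine union_subset (union_subset ?_ ?_) ?_
    · exact α.range_subset_closure hα (cβ.union cδ) lβδ iα ho hn (by rwa [hJα]) (by rwa [hJα])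
    · exact β.range_subset_closure hβ (cα.union cδ) lαδ iβ ho hn (by rwa [hJβ]) (by rwa [hJβ])
    · exact δ.range_subset_closure hδ (cα.union cβ) lαβ iδ ho hn (by rwa [hJδ]) (by rwa [hJδ])
  have hsep : ¬ IsPreconnected Jᶜ := by
    have hr : range (δ.trans β.symm) = range β ∪ range δ := by
      rw [Path.trans_range, Path.symm_range, union_comm]
    have := not_isPreconnected_compl_union hab α (δ.trans β.symm) (by rw [hr, iα])
    rwa [hr, hJα] at this
  obtain ⟨w, hw, hwu, hb⟩ := exists_unbounded_connectedComponentIn cJ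
  obtain ⟨z, hz, hzw⟩ : ∃ z ∉ J, z ∉ connectedComponentIn Jᶜ w := by
    by_contra! h
    refine hsep ?_
    have h' : Jᶜ = connectedComponentIn Jᶜ w :=
      Subset.antisymm h (connectedComponentIn_subset _ _)
    rw [h']
    exact isPreconnected_connectedComponentIn
  refine ⟨connectedComponentIn Jᶜ z, connectedComponentIn Jᶜ w,
    cJ.isClosed.isOpen_compl.connectedComponentIn, cJ.isClosed.isOpen_compl.connectedComponentIn,
    isConnected_connectedComponentIn_iff.2 hz, isConnected_connectedComponentIn_iff.2 hw,
    hb z hz hzw, hwu, ?_, ?_, hclos z hz, hclos w hw⟩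
  · rw [Set.disjoint_left]
    intro y hy hyw
    refine hzw ?_
    rw [connectedComponentIn_eq hyw, ← connectedComponentIn_eq hy]
    exact mem_connectedComponentIn hz
  · refine Subset.antisymm
      (union_subset (connectedComponentIn_subset _ _) (connectedComponentIn_subset _ _)) ?_
    intro y hy
    by_cases hyw : y ∈ connectedComponentIn Jᶜ w
    · exact .inr hyw
    · left
      rw [← hJα] at hz hy ⊢
      refine mem_connectedComponentIn_of_isBounded lα lβδ cα.isClosed (cβ.union cδ).isClosed iα
        hz hy ?_ ?_
      · rw [hJα] at hz ⊢
        exact hb z hz hzw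
      · rw [hJα] at hy ⊢
        exact hb y hy hyw

theorem IsJordanPair.preimage {E F : Type*} [NormedAddCommGroup E] [NormedSpace ℝ E]
    [NormedAddCommGroup F] [NormedSpace ℝ F] (e : E ≃L[ℝ] F) {J U W : Set F}
    (h : IsJordanPair J U W) : IsJordanPair (e ⁻¹' J) (e ⁻¹' U) (e ⁻¹' W) := by
  have him : ∀ S : Set F, e ⁻¹' S = e.symm '' S := fun S ↦
    (e.symm.toEquiv.image_eq_preimage_symm S).symm
  have hcl : ∀ S : Set F, e ⁻¹' closure S = closure (e ⁻¹' S) := fun S ↦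
    e.toHomeomorph.preimage_closure S
  have hbd : ∀ S : Set F, Bornology.IsBounded S → Bornology.IsBounded (e ⁻¹' S) := fun S hS ↦ by
    rw [him]
    exact e.symm.lipschitz.isBounded_image hS
  refine ⟨h.isOpen_left.preimage e.continuous, h.isOpen_right.preimage e.continuous, ?_, ?_,
    hbd _ h.isBounded_left, fun hW ↦ h.not_isBounded_right ?_, h.disjoint.preimage e, ?_, ?_, ?_⟩
  · rw [him]
    exact h.isConnected_left.image _ e.symm.continuous.continuousOn
  · rw [him]
    exact h.isConnected_right.image _ e.symm.continuous.continuousOn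
  · have := e.lipschitz.isBounded_image hW
    rwa [image_preimage_eq W e.surjective] at this
  · rw [← preimage_union, h.union_eq, preimage_compl]
  · rw [← hcl]
    exact preimage_mono h.subset_closure_left
  · rw [← hcl]
    exact preimage_mono h.subset_closure_right

theorem not_injective_of_continuous_complex {f : ℂ → ℝ} (hf : Continuous f) :
    ¬ Function.Injective f := by
  intro hi
  have key : ∀ x y z : ℂ, f x < f y → ¬ f y < f z := by
    intro x y z hxy hyz
    have hc := (isConnected_compl_singleton_of_one_lt_rank (E := ℂ)
      (by rw [Complex.rank_real_complex]; exact Nat.one_lt_ofNat) y).isPreconnected.image f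
      hf.continuousOn
    obtain ⟨w, hw, hwy⟩ := hc.ordConnected.out
      (mem_image_of_mem f (show x ∈ ({y}ᶜ : Set ℂ) from fun e ↦ hxy.ne (congrArg f e)))
      (mem_image_of_mem f (show z ∈ ({y}ᶜ : Set ℂ) from fun e ↦ hyz.ne' (congrArg f e)))
      ⟨hxy.le, hyz.le⟩
    exact hw (hi hwy)
  have h01 : f 0 ≠ f 1 := hi.ne (by norm_num)
  have h02 : f 0 ≠ f 2 := hi.ne (by norm_num)
  have h12 : f 1 ≠ f 2 := hi.ne (by norm_num)
  have k1 := key 0 1 2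
  have k2 := key 0 2 1
  have k3 := key 1 0 2
  have k4 := key 1 2 0
  have k5 := key 2 0 1
  have k6 := key 2 1 0
  grind

theorem Path.interior_range_eq_empty {p q : ℝ × ℝ} (γ : Path p q) (hγ : Function.Injective γ) :
    interior (range γ) = ∅ := by
  by_contra hne
  obtain ⟨x, hx⟩ := nonempty_iff_ne_empty.2 hne
  obtain ⟨r, hr, hball⟩ := Metric.isOpen_iff.1 isOpen_interior x hx
  obtain ⟨σ, hσ, hσγ⟩ := γ.exists_continuousOn_leftInverse hγ
  have hσi : InjOn σ (range γ) := by
    rw [← γ.image_extend_Icc]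
    rintro _ ⟨s, hs, rfl⟩ _ ⟨t, ht, rfl⟩ h
    rw [hσγ s hs, hσγ t ht] at h
    rw [h]
  let φ := OpenPartialHomeomorph.univBall x r
  let e := Complex.equivRealProdCLM
  have hsrc : φ.source = univ := OpenPartialHomeomorph.univBall_source x r
  have hφ : ∀ z, φ z ∈ range γ := fun z ↦ by
    have : φ z ∈ φ.target := φ.map_source (hsrc ▸ mem_univ z)
    rw [OpenPartialHomeomorph.univBall_target x hr] at this
    exact interior_subset (hball this)
  have hφc : Continuous φ := by
    rw [← continuousOn_univ, ← hsrc]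
    exact φ.continuousOn
  refine not_injective_of_continuous_complex (f := fun z ↦ σ (φ (e z))) ?_ ?_
  · exact hσ.comp_continuous (hφc.comp e.continuous) fun z ↦ hφ _
  · intro z w h
    have := φ.injOn (hsrc ▸ mem_univ _) (hsrc ▸ mem_univ _) (hσi (hφ _) (hφ _) h)
    exact e.injective this

theorem connectedComponentIn_compl_eq_of_not_isBounded {K : Set (ℝ × ℝ)} (hK : IsCompact K)
    {x y : ℝ × ℝ} (hx : ¬ Bornology.IsBounded (connectedComponentIn Kᶜ x))
    (hy : ¬ Bornology.IsBounded (connectedComponentIn Kᶜ y)) :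
    connectedComponentIn Kᶜ x = connectedComponentIn Kᶜ y := by
  let e := Complex.equivRealProdCLM.symm
  obtain ⟨R, hR0, hR⟩ := (hK.image e.continuous).isBounded.subset_closedBall_lt 0 0
  have hE := (isPreconnected_compl_closedBall_zero hR0).image e.symm
    e.symm.continuous.continuousOn
  have hEK : e.symm '' (Metric.closedBall (0 : ℂ) R)ᶜ ⊆ Kᶜ := by
    rintro _ ⟨z, hz, rfl⟩ h
    exact hz (hR ⟨_, h, e.apply_symm_apply z⟩)
  have key : ∀ z, ¬ Bornology.IsBounded (connectedComponentIn Kᶜ z) →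
      ∃ w ∈ e.symm '' (Metric.closedBall (0 : ℂ) R)ᶜ, w ∈ connectedComponentIn Kᶜ z := by
    intro z hz
    by_contra! h
    refine hz ((e.symm.lipschitz.isBounded_image
      (Metric.isBounded_closedBall (x := (0 : ℂ)) (r := R))).subset fun w hw ↦
        ⟨e w, ?_, e.symm_apply_apply w⟩)
    by_contra hw'
    exact h w ⟨e w, hw', e.symm_apply_apply w⟩ hw
  obtain ⟨w, hwE, hw⟩ := key x hx
  obtain ⟨w', hwE', hw'⟩ := key y hy
  rw [connectedComponentIn_eq hw, connectedComponentIn_eq hw']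
  exact connectedComponentIn_eq (hE.subset_connectedComponentIn hwE hEK hwE')

theorem exists_isJordanPair_real_prod {a b c : ℝ × ℝ} (α : Path a b) (β : Path b c) (δ : Path a c)
    (hα : Function.Injective α) (hβ : Function.Injective β) (hδ : Function.Injective δ)
    (hαβ : range α ∩ range β = {b}) (hβδ : range β ∩ range δ = {c})
    (hαδ : range α ∩ range δ = {a}) :
    ∃ U W, IsJordanPair (range α ∪ range β ∪ range δ) U W := by
  let e := Complex.equivRealProdCLM.symm
  have hr : ∀ {p q : ℝ × ℝ} (γ : Path p q), range (γ.map e.continuous) = e '' range γ := fun γ ↦ by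
    rw [Path.map_coe, range_comp]
  obtain ⟨U, W, h⟩ := exists_isJordanPair (α.map e.continuous) (β.map e.continuous)
    (δ.map e.continuous) (e.injective.comp hα) (e.injective.comp hβ) (e.injective.comp hδ)
    (by rw [hr, hr, ← image_inter e.injective, hαβ, image_singleton])
    (by rw [hr, hr, ← image_inter e.injective, hβδ, image_singleton])
    (by rw [hr, hr, ← image_inter e.injective, hαδ, image_singleton])
  have h' := h.preimage e
  rw [hr, hr, hr, ← image_union, ← image_union, preimage_image_eq _ e.injective] at h'
  exact ⟨_, _, h'⟩

namespace IsJordanPair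

variable {E : Type*} [TopologicalSpace E] [Bornology E] {J U W F : Set E}

theorem subset_compl_left (h : IsJordanPair J U W) : U ⊆ Jᶜ := h.union_eq ▸ subset_union_left

theorem subset_compl_right (h : IsJordanPair J U W) : W ⊆ Jᶜ := h.union_eq ▸ subset_union_right

theorem subset_left (h : IsJordanPair J U W) (hF : IsPreconnected F) (hJ : F ⊆ Jᶜ)
    (hU : (F ∩ U).Nonempty) : F ⊆ U :=
  hF.subset_left_of_subset_union h.isOpen_left h.isOpen_right h.disjoint (h.union_eq ▸ hJ) hU

theorem subset_right (h : IsJordanPair J U W) (hF : IsPreconnected F) (hJ : F ⊆ Jᶜ)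
    (hW : (F ∩ W).Nonempty) : F ⊆ W :=
  hF.subset_right_of_subset_union h.isOpen_left h.isOpen_right h.disjoint (h.union_eq ▸ hJ) hW

/-- The interior of a closed curve is the only bounded connected open set whose frontier is the
curve. -/
theorem eq_left (h : IsJordanPair J U W) (hFo : IsOpen F) (hFc : IsConnected F)
    (hFb : Bornology.IsBounded F) (hJ : frontier F = J) : F = U := by
  have hFJ : F ⊆ Jᶜ := fun z hz hzJ ↦ by
    rw [← hJ, hFo.frontier_eq] at hzJ
    exact hzJ.2 hz
  have key : ∀ V, IsPreconnected V → V ⊆ Jᶜ → (V ∩ F).Nonempty → V ⊆ F := by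
    intro V hV hVJ hn
    refine hV.subset_of_closure_inter_subset hFo hn fun z hz ↦ ?_
    by_contra hzF
    exact hVJ hz.2 (by rw [← hJ, hFo.frontier_eq]; exact ⟨hz.1, hzF⟩)
  obtain ⟨z, hz⟩ := hFc.nonempty
  have hzJ := hFJ hz
  rw [← h.union_eq] at hzJ
  rcases hzJ with hzU | hzW
  · exact Subset.antisymm (h.subset_left hFc.isPreconnected hFJ ⟨z, hz, hzU⟩)
      (key U h.isConnected_left.isPreconnected h.subset_compl_left ⟨z, hzU, hz⟩)
  · exact (h.not_isBounded_right (hFb.subset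
      (key W h.isConnected_right.isPreconnected h.subset_compl_right ⟨z, hzW, hz⟩))).elim

theorem setOf_isBounded_eq (h : IsJordanPair J U W) :
    {z | z ∉ J ∧ Bornology.IsBounded (connectedComponentIn Jᶜ z)} = U := by
  ext z
  constructor
  · rintro ⟨hz, hb⟩
    have hz' : z ∈ Jᶜ := hz
    rw [← h.union_eq] at hz'
    refine hz'.resolve_right fun hzW ↦ h.not_isBounded_right (hb.subset ?_)
    exact h.isConnected_right.isPreconnected.subset_connectedComponentIn hzW h.subset_compl_right
  · intro hz
    exact ⟨h.subset_compl_left hz, h.isBounded_left.subset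
      (h.subset_left isPreconnected_connectedComponentIn (connectedComponentIn_subset _ _)
        ⟨z, mem_connectedComponentIn (h.subset_compl_left hz), hz⟩)⟩

end IsJordanPair

namespace PlaneGraph

variable {G : PlaneGraph} {F F' : Set (ℝ × ℝ)} {a b c u v x y : ℝ × ℝ}

theorem left_mem_arc (h : G.Adj u v) : u ∈ G.arc u v := by
  obtain ⟨γ, -, hγ⟩ := G.arc_path u v h
  rw [hγ]
  exact ⟨0, γ.source⟩

theorem right_mem_arc (h : G.Adj u v) : v ∈ G.arc u v := by
  obtain ⟨γ, -, hγ⟩ := G.arc_path u v h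
  rw [hγ]
  exact ⟨1, γ.target⟩

theorem drawing_eq (G : PlaneGraph) :
    G.drawing = G.verts ∪ ⋃ p ∈ {p : (ℝ × ℝ) × (ℝ × ℝ) | G.Adj p.1 p.2}, G.arc p.1 p.2 := by
  ext z
  simp [drawing]

theorem finite_setOf_adj (G : PlaneGraph) : {p : (ℝ × ℝ) × (ℝ × ℝ) | G.Adj p.1 p.2}.Finite :=
  (G.finite_verts.prod G.finite_verts).subset fun _ h ↦
    ⟨G.adj_mem _ _ h, G.adj_mem _ _ (G.adj_symm _ _ h)⟩

theorem isCompact_arc (h : G.Adj u v) : IsCompact (G.arc u v) := by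
  obtain ⟨γ, -, hγ⟩ := G.arc_path u v h
  rw [hγ]
  exact isCompact_range γ.continuous

theorem dense_compl_arc (h : G.Adj u v) : Dense (G.arc u v)ᶜ := by
  obtain ⟨γ, hi, hγ⟩ := G.arc_path u v h
  rw [← interior_eq_empty_iff_dense_compl, hγ]
  exact γ.interior_range_eq_empty hi

theorem isCompact_drawing (G : PlaneGraph) : IsCompact G.drawing := by
  rw [drawing_eq]
  exact G.finite_verts.isCompact.union (G.finite_setOf_adj.isCompact_biUnion fun _ h ↦
    isCompact_arc h)

theorem dense_compl_drawing (G : PlaneGraph) : Dense G.drawingᶜ := by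
  rw [drawing_eq, compl_union, compl_iUnion₂]
  exact (G.finite_verts.countable.dense_compl ℝ).inter_of_isOpen_left
    (dense_biInter_of_isOpen (fun _ h ↦ (isCompact_arc h).isClosed.isOpen_compl)
      G.finite_setOf_adj.countable fun _ h ↦ dense_compl_arc h)
    G.finite_verts.isClosed.isOpen_compl

theorem arc_subset_drawing (h : G.Adj u v) : G.arc u v ⊆ G.drawing := by
  rw [drawing_eq]
  exact (subset_biUnion_of_mem (u := fun p : (ℝ × ℝ) × (ℝ × ℝ) ↦ G.arc p.1 p.2)
    (show (u, v) ∈ {p : (ℝ × ℝ) × (ℝ × ℝ) | G.Adj p.1 p.2} from h)).trans subset_union_right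

theorem arc_inter_arc (ha : a ≠ b) (hb : a ≠ c) (hc : b ≠ c) (h : G.Adj a b) (h' : G.Adj b c) :
    G.arc a b ∩ G.arc b c = {b} := by
  refine Subset.antisymm (fun z hz ↦ ?_) ?_
  · have hne : ({a, b} : Set (ℝ × ℝ)) ≠ {b, c} := fun e ↦ by
      have : a ∈ ({b, c} : Set (ℝ × ℝ)) := e ▸ mem_insert a _
      simp_all
    have := G.arc_inter _ _ _ _ h h' hne hz
    simp only [mem_inter_iff, mem_insert_iff, mem_singleton_iff] at this ⊢
    grind
  · rintro _ rfl
    exact ⟨right_mem_arc h, left_mem_arc h'⟩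

theorem triDrawing_swap_left (G : PlaneGraph) (a b c : ℝ × ℝ) :
    G.triDrawing b a c = G.triDrawing a b c := by
  rw [triDrawing, triDrawing, G.arc_symm b a, union_assoc, union_comm (G.arc a c), union_assoc]

theorem triDrawing_swap_right (G : PlaneGraph) (a b c : ℝ × ℝ) :
    G.triDrawing a c b = G.triDrawing a b c := by
  rw [triDrawing, triDrawing, G.arc_symm c b, union_comm, union_comm (G.arc a c), union_assoc]

theorem IsFace.isOpen (h : G.IsFace F) : IsOpen F := by
  obtain ⟨z, -, rfl⟩ := h
  exact G.isCompact_drawing.isClosed.isOpen_compl.connectedComponentIn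

theorem IsFace.isConnected (h : G.IsFace F) : IsConnected F := by
  obtain ⟨z, hz, rfl⟩ := h
  exact isConnected_connectedComponentIn_iff.2 hz

theorem IsFace.subset_compl_drawing (h : G.IsFace F) : F ⊆ G.drawingᶜ := by
  obtain ⟨z, -, rfl⟩ := h
  exact connectedComponentIn_subset _ _

theorem IsFace.eq_of_not_isBounded (h : G.IsFace F) (h' : G.IsFace F')
    (hF : ¬ Bornology.IsBounded F) (hF' : ¬ Bornology.IsBounded F') : F = F' := by
  obtain ⟨z, -, rfl⟩ := h
  obtain ⟨z', -, rfl⟩ := h'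
  exact connectedComponentIn_compl_eq_of_not_isBounded G.isCompact_drawing hF hF'

theorem IsFace.mem_frontier (h : G.IsFace F) (hx : x ∈ closure F) (hxG : x ∈ G.drawing) :
    x ∈ frontier F := by
  rw [h.isOpen.frontier_eq]
  exact ⟨hx, fun hxF ↦ h.subset_compl_drawing hxF hxG⟩

namespace IsTriangle

theorem swap_left (h : G.IsTriangle a b c) : G.IsTriangle b a c :=
  ⟨h.1.symm, h.2.2.1, h.2.1, G.adj_symm _ _ h.2.2.2.1, h.2.2.2.2.2, h.2.2.2.2.1⟩

theorem swap_right (h : G.IsTriangle a b c) : G.IsTriangle a c b :=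
  ⟨h.2.1, h.1, h.2.2.1.symm, h.2.2.2.2.2, G.adj_symm _ _ h.2.2.2.2.1, h.2.2.2.1⟩

/-- The vertices of a triangle can be listed starting with any one of them. -/
theorem exists_of_mem (h : G.IsTriangle a b c) (hx : x ∈ ({a, b, c} : Set (ℝ × ℝ))) :
    ∃ b' c', G.IsTriangle x b' c' ∧ G.triDrawing a b c = G.triDrawing x b' c' ∧
      ({a, b, c} : Set (ℝ × ℝ)) = {x, b', c'} := by
  rcases hx with rfl | rfl | rfl
  · exact ⟨b, c, h, rfl, rfl⟩
  · exact ⟨a, c, h.swap_left, (G.triDrawing_swap_left _ _ _).symm, insert_comm _ _ _⟩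
  · refine ⟨a, b, h.swap_right.swap_left, ?_, ?_⟩
    · exact (G.triDrawing_swap_right a x b).trans (G.triDrawing_swap_left x a b)
    · rw [insert_comm _ a, pair_comm b]

theorem triDrawing_subset (h : G.IsTriangle a b c) : G.triDrawing a b c ⊆ G.drawing :=
  union_subset (union_subset (arc_subset_drawing h.2.2.2.1) (arc_subset_drawing h.2.2.2.2.1))
    (arc_subset_drawing h.2.2.2.2.2)

theorem exists_mem_arc (h : G.IsTriangle a b c) (hx : x ∈ G.triDrawing a b c) :
    ∃ v w, G.Adj v w ∧ x ∈ G.arc v w ∧ ({v, w} : Set (ℝ × ℝ)) ⊆ {a, b, c} := by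
  obtain ⟨-, -, -, hab, hbc, hac⟩ := h
  rcases hx with (hx | hx) | hx
  · exact ⟨a, b, hab, hx, by grind⟩
  · exact ⟨b, c, hbc, hx, by grind⟩
  · exact ⟨a, c, hac, hx, by grind⟩

theorem mem_of_mem_triDrawing (h : G.IsTriangle a b c) (hx : x ∈ G.triDrawing a b c)
    (hxG : x ∈ G.verts) : x ∈ ({a, b, c} : Set (ℝ × ℝ)) := by
  obtain ⟨v, w, hvw, hxvw, hs⟩ := h.exists_mem_arc hx
  exact hs (G.arc_verts v w hvw ⟨hxG, hxvw⟩)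

theorem exists_isJordanPair (h : G.IsTriangle a b c) :
    ∃ U W, IsJordanPair (G.triDrawing a b c) U W := by
  obtain ⟨hab, hac, hbc, Aab, Abc, Aac⟩ := h
  obtain ⟨α, hα, eα⟩ := G.arc_path a b Aab
  obtain ⟨β, hβ, eβ⟩ := G.arc_path b c Abc
  obtain ⟨δ, hδ, eδ⟩ := G.arc_path a c Aac
  rw [triDrawing, eα, eβ, eδ]
  refine exists_isJordanPair_real_prod α β δ hα hβ hδ ?_ ?_ ?_
  · rw [← eα, ← eβ]
    exact arc_inter_arc hab hac hbc Aab Abc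
  · rw [← eβ, ← eδ, G.arc_symm a c]
    exact arc_inter_arc hbc hab.symm hac.symm Abc (G.adj_symm _ _ Aac)
  · rw [← eα, ← eδ, G.arc_symm a b]
    exact arc_inter_arc hab.symm hbc hac (G.adj_symm _ _ Aab) Aac

end IsTriangle

theorem IsTriangularFace.exists_eq_triangleInterior (hF : G.IsFace F)
    (hb : Bornology.IsBounded F) (h : G.IsTriangularFace F) :
    ∃ a b c, G.IsTriangle a b c ∧ frontier F = G.triDrawing a b c ∧
      F = G.triangleInterior a b c := by
  obtain ⟨a, b, c, ht, hfr⟩ := h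
  obtain ⟨U, W, hJ⟩ := ht.exists_isJordanPair
  refine ⟨a, b, c, ht, hfr, ?_⟩
  rw [hJ.eq_left hF.isOpen hF.isConnected hb hfr]
  exact hJ.setOf_isBounded_eq.symm

theorem IsWNT.finite_faces (hG : G.IsWNT) : {F | G.IsFace F}.Finite := by
  have hu : {F | G.IsFace F ∧ ¬ Bornology.IsBounded F}.Subsingleton := fun F h F' h' ↦
    h.1.eq_of_not_isBounded h'.1 h.2 h'.2
  have hfin := (((G.finite_verts.prod (G.finite_verts.prod G.finite_verts)).image
    fun p : (ℝ × ℝ) × (ℝ × ℝ) × (ℝ × ℝ) ↦ G.triangleInterior p.1 p.2.1 p.2.2).union hu.finite)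
  refine hfin.subset fun F hF ↦ ?_
  by_cases hb : Bornology.IsBounded F
  · obtain ⟨a, b, c, ht, -, rfl⟩ :=
      IsTriangularFace.exists_eq_triangleInterior hF hb (hG.1 F hF hb)
    exact .inl ⟨(a, b, c), ⟨G.adj_mem _ _ ht.2.2.2.1, G.adj_mem _ _ ht.2.2.2.2.1,
      G.adj_mem _ _ (G.adj_symm _ _ ht.2.2.2.2.1)⟩, rfl⟩
  · exact .inr ⟨hF, hb⟩

theorem IsWNT.exists_isFace_of_mem_closure (hG : G.IsWNT) {V : Set (ℝ × ℝ)} (hV : IsOpen V)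
    (hx : x ∈ closure V) : ∃ F, G.IsFace F ∧ (F ∩ V).Nonempty ∧ x ∈ closure F := by
  have hx' : x ∈ closure (V ∩ G.drawingᶜ) :=
    closure_minimal (G.dense_compl_drawing.open_subset_closure_inter hV) isClosed_closure hx
  have hfin : {F | G.IsFace F ∧ (F ∩ V).Nonempty}.Finite := hG.finite_faces.subset fun _ h ↦ h.1
  have hsub : V ∩ G.drawingᶜ ⊆ ⋃ F ∈ {F | G.IsFace F ∧ (F ∩ V).Nonempty}, F := fun z hz ↦
    mem_biUnion (x := connectedComponentIn G.drawingᶜ z)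
      ⟨⟨z, hz.2, rfl⟩, z, mem_connectedComponentIn hz.2, hz.1⟩ (mem_connectedComponentIn hz.2)
  have := closure_mono hsub hx'
  rw [hfin.closure_biUnion] at this
  obtain ⟨F, hF, hxF⟩ := mem_iUnion₂.1 this
  exact ⟨F, hF.1, hF.2, hxF⟩

theorem IsBadFor.eq_or_eq (hx : G.IsBadFor u x) (h : G.IsTriangle x b c) : u = b ∨ u = c := by
  by_contra! hu
  exact hx.2.2 ⟨b, c, h.1, h.2.1, h.2.2.1, ⟨h.2.2.2.1, hx.2.1, hu.1.symm⟩,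
    ⟨h.2.2.2.2.1, hu.1.symm, hu.2.symm⟩, ⟨h.2.2.2.2.2, hx.2.1, hu.2.symm⟩⟩

/-- Every triangle through a `u`-bad vertex contains `u`. -/
theorem IsBadFor.exists_isTriangle (hx : G.IsBadFor u x) (h : G.IsTriangle a b c)
    (hxt : x ∈ ({a, b, c} : Set (ℝ × ℝ))) :
    ∃ y, G.IsTriangle u x y ∧ G.triDrawing a b c = G.triDrawing u x y ∧
      ({a, b, c} : Set (ℝ × ℝ)) = {u, x, y} := by
  obtain ⟨b', c', h', hd, hs⟩ := h.exists_of_mem hxt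
  rcases hx.eq_or_eq h' with rfl | rfl
  · exact ⟨c', h'.swap_left, hd.trans (G.triDrawing_swap_left _ _ _).symm,
      hs.trans (insert_comm _ _ _)⟩
  · refine ⟨b', h'.swap_right.swap_left, hd.trans ?_, hs.trans ?_⟩
    · exact (G.triDrawing_swap_right x u b').trans (G.triDrawing_swap_left u x b')
    · rw [pair_comm b', insert_comm]

theorem IsBadFor.exists_isFacialTriangle (hG : G.IsWNT) (hx : G.IsBadFor u x) :
    ∃ y, G.IsFacialTriangle u x y := by
  obtain ⟨b, c, ht⟩ := hG.2 x hx.1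
  obtain ⟨U, W, hJ⟩ := ht.exists_isJordanPair
  have hxJ : x ∈ G.triDrawing x b c := .inl (.inl (left_mem_arc ht.2.2.2.1))
  obtain ⟨F, hF, hFU, hxF⟩ :=
    hG.exists_isFace_of_mem_closure hJ.isOpen_left (hJ.subset_closure_left hxJ)
  have hFs := hJ.subset_left hF.isConnected.isPreconnected
    (hF.subset_compl_drawing.trans (compl_subset_compl.2 ht.triDrawing_subset)) hFU
  have hFb := hJ.isBounded_left.subset hFs
  obtain ⟨a', b', c', ht', hfr, hFi⟩ :=
    IsTriangularFace.exists_eq_triangleInterior hF hFb (hG.1 F hF hFb)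
  have hxt : x ∈ ({a', b', c'} : Set (ℝ × ℝ)) := ht'.mem_of_mem_triDrawing
    (hfr ▸ hF.mem_frontier hxF (ht.triDrawing_subset hxJ)) hx.1
  obtain ⟨y, hy, hd, -⟩ := hx.exists_isTriangle ht' hxt
  have hFy : F = G.triangleInterior u x y := by
    rw [hFi, triangleInterior, hd]
    rfl
  exact ⟨y, hy, hFy ▸ hF⟩

/-- Every inner point of an edge `xy` of a triangle `uxy`, where `x` is `u`-bad, lies on the
boundary of an unbounded face. -/
theorem IsBadFor.exists_not_isBounded (hG : G.IsWNT) (hx : G.IsBadFor u x)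
    (h : G.IsTriangle u x y) {p : ℝ × ℝ} (hp : p ∈ G.arc x y) (hpx : p ≠ x) (hpy : p ≠ y) :
    ∃ F, G.IsFace F ∧ ¬ Bornology.IsBounded F ∧ p ∈ closure F := by
  obtain ⟨U, W, hJ⟩ := h.exists_isJordanPair
  have hpJ : p ∈ G.triDrawing u x y := .inl (.inr hp)
  obtain ⟨F, hF, hFW, hpF⟩ :=
    hG.exists_isFace_of_mem_closure hJ.isOpen_right (hJ.subset_closure_right hpJ)
  refine ⟨F, hF, fun hFb ↦ ?_, hpF⟩
  have hFs := hJ.subset_right hF.isConnected.isPreconnected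
    (hF.subset_compl_drawing.trans (compl_subset_compl.2 h.triDrawing_subset)) hFW
  obtain ⟨a, b, c, ht, hfr⟩ := hG.1 F hF hFb
  have hpt : p ∈ G.triDrawing a b c :=
    hfr ▸ hF.mem_frontier hpF (h.triDrawing_subset hpJ)
  obtain ⟨v, w, hvw, hpvw, hs⟩ := ht.exists_mem_arc hpt
  have hxy : ({x, y} : Set (ℝ × ℝ)) = {v, w} := by
    by_contra hne
    rcases (G.arc_inter _ _ _ _ h.2.2.2.2.1 hvw hne ⟨hp, hpvw⟩).1 with h | h
    exacts [hpx h, hpy h]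
  rw [← hxy] at hs
  obtain ⟨y', -, hd, hs'⟩ := hx.exists_isTriangle ht (hs (mem_insert x _))
  have hyy : y = y' := by
    have hy : y ∈ ({u, x, y'} : Set (ℝ × ℝ)) := hs' ▸ hs (mem_insert_of_mem _ rfl)
    rcases hy with hy | hy | hy
    exacts [(h.2.1 hy.symm).elim, (h.2.2.1 hy.symm).elim, hy]
  subst hyy
  have hFU := hJ.eq_left hF.isOpen hF.isConnected hFb (hfr.trans hd)
  obtain ⟨z, hz, hzW⟩ := hFW
  exact hJ.disjoint.notMem_of_mem_left (hFU ▸ hz) hzW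

theorem IsBadFor.externalVertex (hG : G.IsWNT) (hx : G.IsBadFor u x)
    (h : G.IsTriangle u x y) : G.ExternalVertex x := by
  obtain ⟨γ, hγ, e⟩ := G.arc_path x y h.2.2.2.2.1
  have hinj := γ.extend_injOn hγ
  have key : ∀ t ∈ Ioo (0 : ℝ) 1,
      ∃ F, G.IsFace F ∧ ¬ Bornology.IsBounded F ∧ γ.extend t ∈ closure F := by
    intro t ht
    have ht' := Ioo_subset_Icc_self ht
    refine hx.exists_not_isBounded hG h (e ▸ γ.extend_mem_range t) (fun hp ↦ ht.1.ne' ?_)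
      fun hp ↦ ht.2.ne ?_
    · exact hinj ht' ⟨le_rfl, zero_le_one⟩ (hp.trans γ.extend_zero.symm)
    · exact hinj ht' ⟨zero_le_one, le_rfl⟩ (hp.trans γ.extend_one.symm)
  obtain ⟨F, hF, hFb, -⟩ := key (1 / 2) (by norm_num)
  refine ⟨hx.1, F, hF, hFb, ?_⟩
  have hsub : γ.extend '' Ioo 0 1 ⊆ closure F := by
    rintro _ ⟨t, ht, rfl⟩
    obtain ⟨F', hF', hFb', hm⟩ := key t ht
    rwa [hF.eq_of_not_isBounded hF' hFb hFb']
  have h0 : γ.extend 0 ∈ γ.extend '' closure (Ioo 0 1) :=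
    mem_image_of_mem _ (by rw [closure_Ioo zero_ne_one]; exact ⟨le_rfl, zero_le_one⟩)
  rw [γ.extend_zero] at h0
  exact closure_minimal hsub isClosed_closure
    (image_closure_subset_closure_image γ.continuous_extend h0)

end PlaneGraph

open PlaneGraph in
/-- If `u` is a problematic vertex of a weak near-triangulation `G` and `x` is a
`u`-bad vertex, then `x` is an external vertex of `G`, `x` is adjacent to `u`, and
there is a facial triangle `uxy` in `G`. -/
theorem WNT_bad_vertex_properties (G : PlaneGraph) (hG : G.IsWNT)
    (u x : ℝ × ℝ) (hu : G.Problematic u) (hx : G.IsBadFor u x) :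
    G.ExternalVertex x ∧ G.Adj u x ∧ ∃ y, G.IsFacialTriangle u x y := by
  obtain ⟨y, hy⟩ := hx.exists_isFacialTriangle hG
  exact ⟨hx.externalVertex hG hy.1, hy.1.2.2.2.1, y, hy⟩
end

section
/- Let G be a plane triangulation on n vertices and let G' be an induced subgraph of G that contains all three external vertices of G and is a weak near-triangulation all of whose blocks are outerplanar or have exactly 6 vertices. Then G' is a triangulation and has exactly one block. -/
open Set

/-- A preconnected set meeting both a set and its complement meets its frontier. -/
theorem IsPreconnected.exists_mem_frontier {X : Type*} [TopologicalSpace X] {s t : Set X}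
    (ht : IsPreconnected t) (h : (t ∩ s).Nonempty) (h' : ∃ x ∈ t, x ∉ s) :
    ∃ z ∈ t, z ∈ frontier s := by
  by_contra! hnot
  obtain ⟨x, hxt, hxs⟩ := h
  obtain ⟨y, hyt, hys⟩ := h'
  have hside : ∀ z ∈ t, z ∈ closure s → z ∈ interior s := fun z hz hzc => by
    by_contra hzi
    exact hnot z hz ⟨hzc, hzi⟩
  obtain ⟨z, -, hz, hz'⟩ := ht (interior s) (closure s)ᶜ isOpen_interior
    isClosed_closure.isOpen_compl (fun z hz => or_iff_not_imp_right.2 fun h =>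
      hside z hz (not_not.1 h))
    ⟨x, hxt, hside x hxt (subset_closure hxs)⟩
    ⟨y, hyt, fun h => hys (interior_subset (hside y hyt h))⟩
  exact hz' (subset_closure (interior_subset hz))

/-- If the complement of the intersection of two closed sets is connected, and each component of the
complement of their union has its frontier in exactly one of them, then one contains the other. -/
theorem subset_or_subset_of_frontier_subset {E : Type*} [NormedAddCommGroup E] [NormedSpace ℝ E]
    {K L : Set E} (hK : IsClosed K) (hL : IsClosed L) (hconn : IsPreconnected (K ∩ L)ᶜ)
    (hor : ∀ x ∉ K ∪ L, frontier (connectedComponentIn (K ∪ L)ᶜ x) ⊆ K ∨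
      frontier (connectedComponentIn (K ∪ L)ᶜ x) ⊆ L)
    (hnot : ∀ x ∉ K ∪ L, ¬ frontier (connectedComponentIn (K ∪ L)ᶜ x) ⊆ K ∩ L) :
    K ⊆ L ∨ L ⊆ K := by
  have hempty : ∀ x ∈ K ∪ L, frontier (connectedComponentIn (K ∪ L)ᶜ x) = ∅ := by
    intro x hx
    rw [connectedComponentIn_eq_empty (notMem_compl_iff.2 hx), frontier_empty]
  have isOpen_side : ∀ A B : Set E, IsClosed B →
      (∀ x ∉ K ∪ L, frontier (connectedComponentIn (K ∪ L)ᶜ x) ⊆ A ∨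
        frontier (connectedComponentIn (K ∪ L)ᶜ x) ⊆ B) →
      IsOpen {x | x ∉ B ∧ frontier (connectedComponentIn (K ∪ L)ᶜ x) ⊆ A} := by
    intro A B hB hside
    rw [isOpen_iff_mem_nhds]
    rintro x ⟨hxB, hxA⟩
    by_cases hx : x ∈ K ∪ L
    · obtain ⟨r, hr, hball⟩ := Metric.isOpen_iff.1 hB.isOpen_compl x hxB
      filter_upwards [Metric.ball_mem_nhds x hr] with y hy
      refine ⟨hball hy, ?_⟩
      by_cases hyK : y ∈ K ∪ L
      · exact (hempty y hyK).subset.trans (empty_subset A)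
      · refine (hside y hyK).resolve_right fun hsub => ?_
        obtain ⟨z, hz, hzf⟩ := (convex_ball x r).isPreconnected.exists_mem_frontier
          (s := connectedComponentIn (K ∪ L)ᶜ y) ⟨y, hy, mem_connectedComponentIn hyK⟩
          ⟨x, Metric.mem_ball_self hr, fun h => connectedComponentIn_subset _ _ h hx⟩
        exact hball hz (hsub hzf)
    · have hopen : IsOpen (connectedComponentIn (K ∪ L)ᶜ x) :=
        (hK.union hL).isOpen_compl.connectedComponentIn
      filter_upwards [hopen.mem_nhds (mem_connectedComponentIn hx), hB.isOpen_compl.mem_nhds hxB]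
        with y hy hyB
      exact ⟨hyB, by rwa [← connectedComponentIn_eq hy]⟩
  by_contra! h
  obtain ⟨⟨k, hkK, hkL⟩, l, hlL, hlK⟩ := And.imp not_subset.1 not_subset.1 h
  obtain ⟨z, -, ⟨hzL, hz⟩, hzK, hz'⟩ := hconn _ _ (isOpen_side K L hL hor)
    (isOpen_side L K hK fun x hx => (hor x hx).symm)
    (fun x hx => by
      by_cases hxu : x ∈ K ∪ L
      · rcases hxu with hxK | hxL
        · exact Or.inl ⟨fun hxL => hx ⟨hxK, hxL⟩,
            (hempty x (Or.inl hxK)).subset.trans (empty_subset _)⟩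
        · exact Or.inr ⟨fun hxK => hx ⟨hxK, hxL⟩,
            (hempty x (Or.inr hxL)).subset.trans (empty_subset _)⟩
      · have hxK : x ∉ K := fun h => hxu (Or.inl h)
        have hxL : x ∉ L := fun h => hxu (Or.inr h)
        exact (hor x hxu).imp (fun h => ⟨hxL, h⟩) fun h => ⟨hxK, h⟩)
    ⟨k, fun h => hkL h.2, hkL, (hempty k (Or.inl hkK)).subset.trans (empty_subset _)⟩
    ⟨l, fun h => hlK h.1, hlK, (hempty l (Or.inr hlL)).subset.trans (empty_subset _)⟩
  exact hnot z (fun h => h.elim hzK hzL) (subset_inter hz hz')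

theorem one_lt_rank_real_prod : 1 < Module.rank ℝ (ℝ × ℝ) := by
  apply Module.one_lt_rank_of_one_lt_finrank
  simp

theorem isPreconnected_compl_of_subsingleton {P : Set (ℝ × ℝ)} (hP : P.Subsingleton) :
    IsPreconnected Pᶜ := by
  rcases hP.eq_empty_or_singleton with rfl | ⟨v, rfl⟩
  · simpa using isPreconnected_univ
  · exact (isConnected_compl_singleton_of_one_lt_rank one_lt_rank_real_prod v).isPreconnected

namespace PlaneGraph

theorem adj_mem_right (H : PlaneGraph) {u v : ℝ × ℝ} (h : H.Adj u v) : v ∈ H.verts :=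
  H.adj_mem _ _ (H.adj_symm _ _ h)

theorem left_mem_arc_s16 (H : PlaneGraph) {u v : ℝ × ℝ} (h : H.Adj u v) : u ∈ H.arc u v := by
  obtain ⟨γ, -, hγ⟩ := H.arc_path u v h
  exact hγ ▸ ⟨0, γ.source⟩

theorem arc_subset_drawing_s16 (H : PlaneGraph) {u v : ℝ × ℝ} (h : H.Adj u v) :
    H.arc u v ⊆ H.drawing := fun _ hx =>
  Or.inr (mem_iUnion.2 ⟨u, mem_iUnion.2 ⟨v, mem_iUnion.2 ⟨h, hx⟩⟩⟩)

theorem mem_drawing_iff (H : PlaneGraph) {x : ℝ × ℝ} :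
    x ∈ H.drawing ↔ x ∈ H.verts ∨ ∃ u v, H.Adj u v ∧ x ∈ H.arc u v := by
  simp [drawing]

theorem isCompact_drawing_s16 (H : PlaneGraph) : IsCompact H.drawing := by
  have heq : H.drawing = H.verts ∪
      ⋃ p ∈ {p : (ℝ × ℝ) × (ℝ × ℝ) | H.Adj p.1 p.2}, H.arc p.1 p.2 := by
    ext x
    simp [drawing]
  rw [heq]
  refine H.finite_verts.isCompact.union (Set.Finite.isCompact_biUnion ?_ ?_)
  · exact (H.finite_verts.prod H.finite_verts).subset
      fun p hp => ⟨H.adj_mem _ _ hp, H.adj_mem_right hp⟩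
  · intro p hp
    obtain ⟨γ, -, hγ⟩ := H.arc_path _ _ hp
    exact hγ ▸ isCompact_range γ.continuous

theorem triDrawing_subset_drawing (H : PlaneGraph) {a b c : ℝ × ℝ} (h : H.IsTriangle a b c) :
    H.triDrawing a b c ⊆ H.drawing := by
  obtain ⟨-, -, -, hab, hbc, hac⟩ := h
  exact union_subset (union_subset (H.arc_subset_drawing_s16 hab) (H.arc_subset_drawing_s16 hbc))
    (H.arc_subset_drawing_s16 hac)

theorem mem_triDrawing (H : PlaneGraph) {a b c : ℝ × ℝ} (h : H.IsTriangle a b c) :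
    a ∈ H.triDrawing a b c ∧ b ∈ H.triDrawing a b c ∧ c ∈ H.triDrawing a b c := by
  obtain ⟨-, -, -, hab, hbc, hac⟩ := h
  refine ⟨Or.inl (Or.inl (H.left_mem_arc_s16 hab)), Or.inl (Or.inr (H.left_mem_arc_s16 hbc)), Or.inr ?_⟩
  rw [H.arc_symm]
  exact H.left_mem_arc_s16 (H.adj_symm _ _ hac)

theorem IsTriangle.induce {H : PlaneGraph} {a b c : ℝ × ℝ} (h : H.IsTriangle a b c)
    {S : Set (ℝ × ℝ)} (ha : a ∈ S) (hb : b ∈ S) (hc : c ∈ S) : (H.induce S).IsTriangle a b c :=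
  ⟨h.1, h.2.1, h.2.2.1, ⟨h.2.2.2.1, ha, hb⟩, ⟨h.2.2.2.2.1, hb, hc⟩, ⟨h.2.2.2.2.2, ha, hc⟩⟩

theorem induce_drawing_subset (H : PlaneGraph) (S : Set (ℝ × ℝ)) :
    (H.induce S).drawing ⊆ H.drawing := by
  intro x hx
  rw [mem_drawing_iff] at hx ⊢
  rcases hx with hx | ⟨u, v, huv, hx⟩
  · exact Or.inl hx.1
  · exact Or.inr ⟨u, v, huv.1, hx⟩

theorem induce_verts_self (H : PlaneGraph) : H.induce H.verts = H := by
  have hadj : (H.induce H.verts).Adj = H.Adj := by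
    ext u v
    exact ⟨fun h => h.1, fun h => ⟨h, H.adj_mem _ _ h, H.adj_mem_right h⟩⟩
  have hverts : (H.induce H.verts).verts = H.verts := inter_self _
  have harc : (H.induce H.verts).arc = H.arc := rfl
  generalize H.induce H.verts = H' at *
  cases H'
  cases H
  simp_all

/-- Two induced subgraphs sharing at most one vertex have drawings sharing at most that vertex. -/
theorem induce_drawing_inter_subset (H : PlaneGraph) {S T : Set (ℝ × ℝ)}
    (hST : (S ∩ T).Subsingleton) :
    (H.induce S).drawing ∩ (H.induce T).drawing ⊆ S ∩ T := by
  rintro x ⟨hxS, hxT⟩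
  rw [mem_drawing_iff] at hxS hxT
  rcases hxS with ⟨hx, hxS⟩ | ⟨u, v, ⟨huv, hu, hv⟩, hx⟩
  · rcases hxT with ⟨-, hxT⟩ | ⟨u', v', ⟨huv', hu', hv'⟩, hx'⟩
    · exact ⟨hxS, hxT⟩
    · rcases H.arc_verts _ _ huv' ⟨hx, hx'⟩ with rfl | rfl
      exacts [⟨hxS, hu'⟩, ⟨hxS, hv'⟩]
  · rcases hxT with ⟨hx', hxT⟩ | ⟨u', v', ⟨huv', hu', hv'⟩, hx'⟩
    · rcases H.arc_verts _ _ huv ⟨hx', hx⟩ with rfl | rfl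
      exacts [⟨hu, hxT⟩, ⟨hv, hxT⟩]
    · have hpair : ({u', v'} : Set (ℝ × ℝ)) ⊆ T := pair_subset hu' hv'
      by_cases heq : ({u, v} : Set (ℝ × ℝ)) = {u', v'}
      · rw [← heq] at hpair
        have huv_eq : u = v := hST ⟨hu, hpair (by simp)⟩ ⟨hv, hpair (by simp)⟩
        exact (H.adj_irrefl v (huv_eq ▸ huv)).elim
      · obtain ⟨h, h'⟩ := H.arc_inter _ _ _ _ huv huv' heq ⟨hx, hx'⟩
        exact ⟨pair_subset hu hv h, hpair h'⟩

/-- If all faces are triangular, then a nonempty set of vertices whose neighbours outside it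
lie in a set `P` of at most one vertex contains all vertices outside `P`. -/
theorem verts_subset_union_of_faces_triangular (H : PlaneGraph)
    (hfaces : ∀ F, H.IsFace F → H.IsTriangularFace F) {P C : Set (ℝ × ℝ)}
    (hP : P.Subsingleton) (hPv : P ⊆ H.verts) (hCv : C ⊆ H.verts) (hCP : Disjoint C P)
    (hC : C.Nonempty) (hadj : ∀ u ∈ C, ∀ w, H.Adj u w → w ∈ C ∪ P) :
    H.verts ⊆ C ∪ P := by
  have hST : (C ∪ P) ∩ Cᶜ = P := by
    rw [union_inter_distrib_right, inter_compl_self, empty_union, inter_eq_left]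
    exact hCP.subset_compl_left
  set K := (H.induce (C ∪ P)).drawing
  set L := (H.induce Cᶜ).drawing
  have hinter : K ∩ L = P := by
    refine Subset.antisymm ?_ fun p hp => ⟨Or.inl ⟨hPv hp, Or.inr hp⟩, Or.inl ⟨hPv hp, ?_⟩⟩
    · rw [← hST]
      exact H.induce_drawing_inter_subset (hST.symm ▸ hP)
    · exact fun hpC => hCP.le_bot ⟨hpC, hp⟩
  have hunion : K ∪ L = H.drawing := by
    refine Subset.antisymm
      (union_subset (H.induce_drawing_subset _) (H.induce_drawing_subset _)) fun x hx => ?_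
    rcases H.mem_drawing_iff.1 hx with hx | ⟨u, v, huv, hx⟩
    · by_cases hxC : x ∈ C
      · exact Or.inl (Or.inl ⟨hx, Or.inl hxC⟩)
      · exact Or.inr (Or.inl ⟨hx, hxC⟩)
    · by_cases hu : u ∈ C
      · exact Or.inl (arc_subset_drawing_s16 (H.induce (C ∪ P)) (u := u) (v := v)
          ⟨huv, Or.inl hu, hadj u hu v huv⟩ hx)
      · by_cases hv : v ∈ C
        · exact Or.inl (arc_subset_drawing_s16 (H.induce (C ∪ P)) (u := u) (v := v)
            ⟨huv, hadj v hv u (H.adj_symm _ _ huv), Or.inl hv⟩ hx)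
        · exact Or.inr (arc_subset_drawing_s16 (H.induce Cᶜ) (u := u) (v := v) ⟨huv, hu, hv⟩ hx)
  have htri : ∀ x ∉ K ∪ L, ∃ a b c, H.IsTriangle a b c ∧
      frontier (connectedComponentIn (K ∪ L)ᶜ x) = H.triDrawing a b c := by
    intro x hx
    rw [hunion] at hx ⊢
    exact hfaces _ ⟨x, hx, rfl⟩
  have hsub := subset_or_subset_of_frontier_subset (K := K) (L := L)
    (isCompact_drawing_s16 _).isClosed (isCompact_drawing_s16 _).isClosed
    (hinter ▸ isPreconnected_compl_of_subsingleton hP)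
    (fun x hx => by
      obtain ⟨a, b, c, habc, hfr⟩ := htri x hx
      have ⟨_, _, _, hab, hbc, hac⟩ := habc
      have hba := H.adj_symm _ _ hab
      have hcb := H.adj_symm _ _ hbc
      have hca := H.adj_symm _ _ hac
      rw [hfr]
      by_cases ha : a ∈ C
      · exact Or.inl (triDrawing_subset_drawing _
          (habc.induce (Or.inl ha) (hadj a ha b hab) (hadj a ha c hac)))
      by_cases hb : b ∈ C
      · exact Or.inl (triDrawing_subset_drawing _
          (habc.induce (hadj b hb a hba) (Or.inl hb) (hadj b hb c hbc)))
      by_cases hc : c ∈ C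
      · exact Or.inl (triDrawing_subset_drawing _
          (habc.induce (hadj c hc a hca) (hadj c hc b hcb) (Or.inl hc)))
      exact Or.inr (triDrawing_subset_drawing _ (habc.induce ha hb hc)))
    (fun x hx hsub => by
      obtain ⟨a, b, c, habc, hfr⟩ := htri x hx
      rw [hfr, hinter] at hsub
      have hmem := H.mem_triDrawing habc
      exact habc.1 (hP (hsub hmem.1) (hsub hmem.2.1)))
  intro w hw
  by_contra hwCP
  obtain ⟨c, hc⟩ := hC
  have hcK : c ∈ K := Or.inl ⟨hCv hc, Or.inl hc⟩
  have hwL : w ∈ L := Or.inl ⟨hw, fun h => hwCP (Or.inl h)⟩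
  rcases hsub with h | h
  · exact hCP.le_bot ⟨hc, hinter ▸ ⟨hcK, h hcK⟩⟩
  · exact hwCP (Or.inr (hinter ▸ ⟨h hwL, hwL⟩))

theorem connected_of_faces_triangular (H : PlaneGraph) (hne : H.verts.Nonempty)
    (hfaces : ∀ F, H.IsFace F → H.IsTriangularFace F) : H.Connected := by
  refine ⟨hne, fun u hu v hv => ?_⟩
  have hsub := H.verts_subset_union_of_faces_triangular hfaces (P := ∅)
    (C := {x | x ∈ H.verts ∧ H.Reachable u x}) subsingleton_empty (empty_subset _)
    (fun x hx => hx.1) (disjoint_empty _) ⟨u, hu, Relation.ReflTransGen.refl⟩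
    (fun x hx w hw => Or.inl ⟨H.adj_mem_right hw, hx.2.tail hw⟩)
  exact (hsub hv).elim (fun h => h.2) fun h => h.elim

theorem not_isCutvertex_of_faces_triangular (H : PlaneGraph)
    (hfaces : ∀ F, H.IsFace F → H.IsTriangularFace F) (v : ℝ × ℝ) : ¬ H.IsCutvertex v := by
  rintro ⟨hv, a, b, ha, hb, hav, hbv, -, hab⟩
  have hsub := H.verts_subset_union_of_faces_triangular hfaces (P := {v})
    (C := {x | x ∈ H.verts ∧ x ≠ v ∧ (H.erase v).Reachable a x}) subsingleton_singleton
    (singleton_subset_iff.2 hv) (fun x hx => hx.1)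
    (disjoint_singleton_right.2 fun h => h.2.1 rfl) ⟨a, ha, hav, Relation.ReflTransGen.refl⟩
    (fun x hx w hw => by
      by_cases hwv : w = v
      · exact Or.inr hwv
      · exact Or.inl ⟨H.adj_mem_right hw, hwv, hx.2.2.tail ⟨hw, hx.2.1, hwv⟩⟩)
  exact (hsub hb).elim (fun h => hab h.2.2) hbv

theorem existsUnique_isBlock (H : PlaneGraph) (hconn : H.Connected)
    (hcut : ∀ v, ¬ H.IsCutvertex v) : ∃! B, H.IsBlock B := by
  refine ⟨H.verts, ⟨Subset.rfl, ?_, ?_, fun B' h h' _ _ => h'.antisymm h⟩, fun B hB => ?_⟩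
  · rwa [H.induce_verts_self]
  · rwa [H.induce_verts_self]
  · refine (hB.2.2.2 H.verts hB.1 Subset.rfl ?_ ?_).symm <;> rwa [H.induce_verts_self]

/-- Every point outside some large ball lies in an unbounded face. -/
theorem exists_forall_not_isBounded_connectedComponentIn (H : PlaneGraph) :
    ∃ R : ℝ, ∀ x ∉ Metric.closedBall (0 : ℝ × ℝ) R, x ∉ H.drawing ∧
      ¬ Bornology.IsBounded (connectedComponentIn H.drawingᶜ x) := by
  obtain ⟨R, hR0, hR⟩ := H.isCompact_drawing_s16.isBounded.subset_closedBall_lt 0 0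
  refine ⟨R, fun x hx => ⟨fun h => hx (hR h), fun hb => ?_⟩⟩
  have hxR : R < ‖x‖ := by simpa using hx
  have hx0 : 0 < ‖x‖ := hR0.trans hxR
  have hray : (fun t : ℝ => t • x) '' Ici 1 ⊆ connectedComponentIn H.drawingᶜ x := by
    refine (isPreconnected_Ici.image _ (by fun_prop)).subset_connectedComponentIn
      ⟨1, self_mem_Ici, one_smul _ _⟩ ?_
    rintro _ ⟨t, ht, rfl⟩ hmem
    have hle := hR hmem
    rw [mem_closedBall_zero_iff, norm_smul, Real.norm_eq_abs, 
      abs_of_pos (by linarith [mem_Ici.1 ht])]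
      at hle
    nlinarith [mem_Ici.1 ht]
  obtain ⟨M, hM0, hM⟩ := (hb.subset hray).subset_closedBall_lt 0 0
  have hle := hM ⟨1 + M / ‖x‖, by simpa using (div_pos hM0 hx0).le, rfl⟩
  have hpos : 0 < 1 + M / ‖x‖ := by positivity
  rw [mem_closedBall_zero_iff, norm_smul, Real.norm_eq_abs, abs_of_pos hpos, add_mul,
    div_mul_cancel₀ _ hx0.ne'] at hle
  linarith

/-- The boundary triangle of an unbounded face survives in any induced subgraph containing
all external vertices. -/
theorem exists_isTriangle_induce_frontier_eq (G : PlaneGraph) {S F : Set (ℝ × ℝ)}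
    (hext : ∀ v, G.ExternalVertex v → v ∈ S) (hF : G.IsFace F) (hb : ¬ Bornology.IsBounded F)
    (htri : G.IsTriangularFace F) : ∃ a b c, (G.induce S).IsTriangle a b c ∧
      frontier F = (G.induce S).triDrawing a b c := by
  obtain ⟨a, b, c, habc, hfr⟩ := htri
  have ⟨_, _, _, hab, hbc, _⟩ := habc
  have hmem := G.mem_triDrawing habc
  rw [← hfr] at hmem
  have hS : ∀ w ∈ G.verts, w ∈ frontier F → w ∈ S := fun w hw hwF =>
    hext w ⟨hw, F, hF, hb, frontier_subset_closure hwF⟩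
  exact ⟨a, b, c, habc.induce (hS a (G.adj_mem _ _ hab) hmem.1)
    (hS b (G.adj_mem _ _ hbc) hmem.2.1) (hS c (G.adj_mem_right hbc) hmem.2.2), hfr⟩

end PlaneGraph

open PlaneGraph in
/-- Let `G` be a plane triangulation and `G'` an induced subgraph of `G` that contains
all (three) external vertices of `G` and is a weak near-triangulation all of whose
blocks are outerplanar or have exactly 6 vertices. Then `G'` is a triangulation and
has exactly one block. -/
theorem triangulation_induced_WNT (G : PlaneGraph) (hG : G.IsTriangulation)
    (S : Set (ℝ × ℝ)) (hS : S ⊆ G.verts)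
    (hext : ∀ v, G.ExternalVertex v → v ∈ S)
    (hWNT : (G.induce S).IsWNT)
    (hblocks : ∀ B, (G.induce S).IsBlock B →
      ((G.induce S).induce B).IsOuterplanar ∨ B.ncard = 6) :
    (G.induce S).IsTriangulation ∧ ∃! B, (G.induce S).IsBlock B := by
  obtain ⟨R, hR⟩ := G.exists_forall_not_isBounded_connectedComponentIn
  have houter : ∀ x ∉ Metric.closedBall (0 : ℝ × ℝ) R, ∃ a b c, (G.induce S).IsTriangle a b c ∧
      frontier (connectedComponentIn G.drawingᶜ x) = (G.induce S).triDrawing a b c := by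
    intro x hx
    have hface : G.IsFace (connectedComponentIn G.drawingᶜ x) := ⟨x, (hR x hx).1, rfl⟩
    exact G.exists_isTriangle_induce_frontier_eq hext hface (hR x hx).2 (hG.2 _ hface)
  have hfaces : ∀ F, (G.induce S).IsFace F → (G.induce S).IsTriangularFace F := by
    intro F hF
    by_cases hb : Bornology.IsBounded F
    · exact hWNT.1 F hF hb
    obtain ⟨y, -, rfl⟩ := hF
    obtain ⟨x, hxF, hx⟩ := not_subset.1 fun h => hb (Metric.isBounded_closedBall.subset h)
    obtain ⟨a, b, c, habc, hfr⟩ := houter x hx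
    refine ⟨a, b, c, habc, ?_⟩
    rw [← hfr]
    congr 1
    have hxmem : x ∈ connectedComponentIn G.drawingᶜ x := mem_connectedComponentIn (hR x hx).1
    apply Subset.antisymm
    · by_contra hnot
      obtain ⟨w, hwF, hw⟩ := not_subset.1 hnot
      obtain ⟨z, hzF, hz⟩ := isPreconnected_connectedComponentIn.exists_mem_frontier
        ⟨x, hxF, hxmem⟩ ⟨w, hwF, hw⟩
      rw [hfr] at hz
      exact connectedComponentIn_subset _ _ hzF (triDrawing_subset_drawing _ habc hz)
    · rw [connectedComponentIn_eq hxF]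
      exact connectedComponentIn_mono x (compl_subset_compl.2 (G.induce_drawing_subset S))
  have hne : (G.induce S).verts.Nonempty := by
    obtain ⟨x, -, hx⟩ := not_subset.1 fun h : univ ⊆ Metric.closedBall (0 : ℝ × ℝ) R =>
      NormedSpace.unbounded_univ ℝ (ℝ × ℝ) (Metric.isBounded_closedBall.subset h)
    obtain ⟨a, b, c, ⟨-, -, -, hab, -⟩, -⟩ := houter x hx
    exact ⟨a, adj_mem _ _ _ hab⟩
  have hconn := (G.induce S).connected_of_faces_triangular hne hfaces
  exact ⟨⟨hconn, hfaces⟩, (G.induce S).existsUnique_isBlock hconn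
    ((G.induce S).not_isCutvertex_of_faces_triangular hfaces)⟩
end
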